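/- arXiv:1507.04187 — 3 statements merged into one kernel-verified Lean document; each statement's English description precedes it below -/
import Mathlib

section
/- Let d ≥ 1, let C > 0, and let ρ_n be Borel probability measures on ℝ^d converging weakly to a probability measure ρ, with ∫|x| dρ_n(x) ≤ C and E(ρ_n) ≤ C for all n. Then E(ρ) ≤ liminf_n E(ρ_n). -/
open MeasureTheory Real Filter Topology
open scoped ENNReal RealInnerProductSpace

noncomputable section

/-- `d`-dimensional Euclidean space. -/
abbrev Ed (d : ℕ) := EuclideanSpace ℝ (Fin d)

open Classical in
/-- The entropy `E(ρ) = ∫ f ln f dx` (extended-real-valued, computed as positive part minus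
negative part of the integral of `f ln f`, where `f` is the density), and `+∞` if `ρ` is not
absolutely continuous w.r.t. Lebesgue measure. -/
def entropy {d : ℕ} (ρ : Measure (Ed d)) : EReal :=
  if ρ ≪ (volume : Measure (Ed d)) then
    ((∫⁻ x, ENNReal.ofReal ((ρ.rnDeriv volume x).toReal *
        Real.log (ρ.rnDeriv volume x).toReal) : ℝ≥0∞) : EReal)
      - ((∫⁻ x, ENNReal.ofReal (-((ρ.rnDeriv volume x).toReal *
        Real.log (ρ.rnDeriv volume x).toReal)) : ℝ≥0∞) : EReal)
  else ⊤

/-- The (extended-real-valued) integral `∫ ⟨x,y⟩ dγ(x,y)`: positive part minus negative part. -/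
def pairInt {d : ℕ} (γ : Measure (Ed d × Ed d)) : EReal :=
  ((∫⁻ p, ENNReal.ofReal (⟪p.1, p.2⟫ : ℝ) ∂γ : ℝ≥0∞) : EReal)
    - ((∫⁻ p, ENNReal.ofReal (-(⟪p.1, p.2⟫ : ℝ)) ∂γ : ℝ≥0∞) : EReal)

/-- Transport plans: probability measures on the product with marginals `ρ` and `μ`. -/
def Couplings {d : ℕ} (ρ μ : Measure (Ed d)) : Set (Measure (Ed d × Ed d)) :=
  {γ | IsProbabilityMeasure γ ∧ γ.fst = ρ ∧ γ.snd = μ}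

/-- The maximal correlation functional `T(ρ,μ) = sup { ∫⟨x,y⟩ dγ : γ ∈ Π(ρ,μ) }`. -/
def maxCorr {d : ℕ} (ρ μ : Measure (Ed d)) : EReal :=
  ⨆ γ ∈ Couplings ρ μ, pairInt γ

/-- `ρ` has finite first moment. -/
def FirstMoment {d : ℕ} (ρ : Measure (Ed d)) : Prop := Integrable (fun x => ‖x‖) ρ

/-- `ρ` is centered: its barycenter is `0`. -/
def Centered {d : ℕ} (ρ : Measure (Ed d)) : Prop := (∫ x, x ∂ρ) = 0

/-- Weak convergence of measures: convergence of integrals of bounded continuous functions. -/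
def WeakConv {d : ℕ} (ρs : ℕ → Measure (Ed d)) (ρ : Measure (Ed d)) : Prop :=
  ∀ f : BoundedContinuousFunction (Ed d) ℝ,
    Tendsto (fun n => ∫ x, f x ∂(ρs n)) atTop (𝓝 (∫ x, f x ∂ρ))

/-- Convexity for extended-real-valued functions on `Ed d`. -/
def EConvexOn {d : ℕ} (u : Ed d → EReal) : Prop :=
  ∀ x y : Ed d, ∀ a b : ℝ, 0 ≤ a → 0 ≤ b → a + b = 1 →
    u (a • x + b • y) ≤ (a : EReal) * u x + (b : EReal) * u y

/-- `e^{-t}` for `t ∈ ℝ ∪ {+∞}`, with `e^{-∞} = 0`. -/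
def expNegE (t : EReal) : ℝ := if t = ⊤ then 0 else Real.exp (-t.toReal)

/-- The Legendre transform `u*(y) = sup_x (⟨x,y⟩ - u(x))`. -/
def legendre {d : ℕ} (u : Ed d → EReal) (y : Ed d) : EReal :=
  ⨆ x : Ed d, (((⟪x, y⟫ : ℝ) : EReal) - u x)

/-- The essential continuity of a convex l.s.c. function `u : ℝ^d → ℝ ∪ {+∞}`:
`u` tends to `+∞` at `H^{d-1}`-a.e. point of the boundary of its domain. -/
def EssentiallyContinuous {d : ℕ} (u : Ed d → EReal) : Prop :=
  μH[(d : ℝ) - 1] {x : Ed d | x ∈ frontier {y | u y < ⊤} ∧ u x < ⊤} = 0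

/-- Scalar Fenchel–Young inequality for the function `a ↦ a log a`. -/
lemma mul_sub_exp_le_mul_log {a : ℝ} (ha : 0 ≤ a) (t : ℝ) :
    a * t - exp (t - 1) ≤ a * log a := by
  rcases ha.eq_or_lt with rfl | ha
  · simpa using (exp_pos _).le
  · have h := add_one_le_exp (t - 1 - log a)
    have h' : a * exp (t - 1 - log a) = exp (t - 1) := by
      rw [exp_sub, exp_log ha]
      field_simp
    nlinarith

lemma mul_log_sub_add_one_nonneg {c : ℝ} (hc : 0 < c) : 0 ≤ c * log c - c + 1 := by
  have h := mul_sub_exp_le_mul_log hc.le 1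
  simp only [mul_one, sub_self, exp_zero] at h
  linarith

lemma EReal.coe_integral_eq_lintegral_sub {α : Type*} [MeasurableSpace α] {μ : Measure α}
    {k : α → ℝ} (hk : Integrable k μ) :
    ((∫ x, k x ∂μ : ℝ) : EReal) = ((∫⁻ x, ENNReal.ofReal (k x) ∂μ : ℝ≥0∞) : EReal)
      - ((∫⁻ x, ENNReal.ofReal (-k x) ∂μ : ℝ≥0∞) : EReal) := by
  have h1 : (∫⁻ x, ENNReal.ofReal (k x) ∂μ) ≠ ⊤ := hk.lintegral_lt_top.ne
  have h2 : (∫⁻ x, ENNReal.ofReal (-k x) ∂μ) ≠ ⊤ := hk.neg.lintegral_lt_top.ne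
  rw [integral_eq_lintegral_pos_part_sub_lintegral_neg_part hk, EReal.coe_sub,
    EReal.coe_ennreal_toReal h1, EReal.coe_ennreal_toReal h2]

lemma EReal.coe_integral_le_lintegral_sub {α : Type*} [MeasurableSpace α] {μ : Measure α}
    {k u : α → ℝ} (hk : Integrable k μ) (hku : ∀ x, k x ≤ u x) :
    ((∫ x, k x ∂μ : ℝ) : EReal) ≤ ((∫⁻ x, ENNReal.ofReal (u x) ∂μ : ℝ≥0∞) : EReal)
      - ((∫⁻ x, ENNReal.ofReal (-u x) ∂μ : ℝ≥0∞) : EReal) := by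
  rw [EReal.coe_integral_eq_lintegral_sub hk]
  refine EReal.sub_le_sub ?_ ?_ <;> refine EReal.coe_ennreal_le_coe_ennreal_iff.2 ?_
  · exact lintegral_mono fun x => ENNReal.ofReal_le_ofReal (hku x)
  · exact lintegral_mono fun x => ENNReal.ofReal_le_ofReal (neg_le_neg (hku x))

/-- Fatou's lemma for nonnegative real functions with uniformly bounded integrals. -/
lemma integrable_and_integral_le_of_tendsto {α : Type*} [MeasurableSpace α] {μ : Measure α}
    {F : ℕ → α → ℝ} {G : α → ℝ} {B : ℝ} (hF : ∀ k, Integrable (F k) μ)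
    (hF0 : ∀ k x, 0 ≤ F k x) (hFG : ∀ x, Tendsto (fun k => F k x) atTop (𝓝 (G x)))
    (hB : ∀ k, ∫ x, F k x ∂μ ≤ B) :
    Integrable G μ ∧ ∫ x, G x ∂μ ≤ B := by
  have hG0 : ∀ x, 0 ≤ G x := fun x => ge_of_tendsto' (hFG x) fun k => hF0 k x
  have hGm : AEStronglyMeasurable G μ :=
    aestronglyMeasurable_of_tendsto_ae atTop (fun k => (hF k).1) (ae_of_all _ hFG)
  have hle : ∫⁻ x, ENNReal.ofReal (G x) ∂μ ≤ ENNReal.ofReal B := by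
    calc ∫⁻ x, ENNReal.ofReal (G x) ∂μ
        = ∫⁻ x, liminf (fun k => ENNReal.ofReal (F k x)) atTop ∂μ :=
          lintegral_congr fun x => ((ENNReal.tendsto_ofReal (hFG x)).liminf_eq).symm
      _ ≤ liminf (fun k => ∫⁻ x, ENNReal.ofReal (F k x) ∂μ) atTop :=
          lintegral_liminf_le' fun k => (hF k).1.aemeasurable.ennreal_ofReal
      _ ≤ ENNReal.ofReal B := by
          refine liminf_le_of_frequently_le' (Frequently.of_forall fun k => ?_)
          rw [← ofReal_integral_eq_lintegral_ofReal (hF k) (ae_of_all _ (hF0 k))]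
          exact ENNReal.ofReal_le_ofReal (hB k)
  have hB0 : 0 ≤ B := (integral_nonneg (hF0 0)).trans (hB 0)
  refine ⟨⟨hGm, ?_⟩, ?_⟩
  · rw [hasFiniteIntegral_iff_ofReal (ae_of_all _ hG0)]
    exact hle.trans_lt ENNReal.ofReal_lt_top
  · rw [integral_eq_lintegral_of_nonneg_ae (ae_of_all _ hG0) hGm]
    exact ENNReal.toReal_le_of_le_ofReal hB0 hle

/-- Entropy dominates its Legendre-dual lower bounds. -/
lemma integral_sub_integral_exp_le_entropy {d : ℕ} (μ : Measure (Ed d)) [IsFiniteMeasure μ]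
    {g : Ed d → ℝ} (hg : Integrable g μ)
    (hexp : Integrable (fun x => exp (g x - 1)) (volume : Measure (Ed d))) :
    ((∫ x, g x ∂μ - ∫ x, exp (g x - 1) : ℝ) : EReal) ≤ entropy μ := by
  unfold entropy
  split_ifs with hac
  · have hi : Integrable (fun x => (μ.rnDeriv volume x).toReal * g x)
        (volume : Measure (Ed d)) := (integrable_toReal_rnDeriv_mul_iff hac).2 hg
    rw [← integral_toReal_rnDeriv_mul hac, ← integral_sub hi hexp]
    exact EReal.coe_integral_le_lintegral_sub (hi.sub hexp)
      fun x => mul_sub_exp_le_mul_log ENNReal.toReal_nonneg _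
  · exact le_top

/-- A weight of logarithmic growth, whose Gibbs density is integrable on `ℝ^d`. -/
def logWeight (d : ℕ) (x : Ed d) : ℝ := (d + 1) * log (1 + ‖x‖)

lemma logWeight_nonneg {d : ℕ} (x : Ed d) : 0 ≤ logWeight d x :=
  mul_nonneg (by positivity) (log_nonneg (by linarith [norm_nonneg x]))

lemma continuous_logWeight (d : ℕ) : Continuous (logWeight d) := by
  unfold logWeight
  exact continuous_const.mul
    ((continuous_const.add continuous_norm).log fun x =>
      (add_pos_of_pos_of_nonneg one_pos (norm_nonneg x)).ne')

lemma logWeight_le {d : ℕ} {δ : ℝ} (hδ : 0 < δ) (x : Ed d) :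
    logWeight d x ≤ (d + 1) * (δ - log δ - 1) + (d + 1) * δ * ‖x‖ := by
  have h1 : 0 < 1 + ‖x‖ := by positivity
  have h := log_le_sub_one_of_pos (mul_pos hδ h1)
  rw [log_mul hδ.ne' h1.ne'] at h
  have : log (1 + ‖x‖) ≤ (δ - log δ - 1) + δ * ‖x‖ := by linarith
  have h2 := mul_le_mul_of_nonneg_left this (by positivity : (0 : ℝ) ≤ d + 1)
  unfold logWeight
  linarith

lemma integrable_exp_neg_logWeight (d : ℕ) :
    Integrable (fun x => exp (-logWeight d x - 1)) (volume : Measure (Ed d)) := by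
  have h := (integrable_one_add_norm (E := Ed d) (μ := volume) (r := d + 1)
    (by simp)).mul_const (exp (-1))
  refine h.congr (ae_of_all _ fun x => ?_)
  have h1 : 0 < 1 + ‖x‖ := by positivity
  simp only [logWeight]
  rw [rpow_def_of_pos h1, ← exp_add]
  ring_nf

/-- The finite measure on `ℝ^d` with density `exp (-logWeight - 1)`. -/
def logWeightMeasure (d : ℕ) : Measure (Ed d) :=
  volume.withDensity fun x => ENNReal.ofReal (exp (-logWeight d x - 1))

instance (d : ℕ) : IsFiniteMeasure (logWeightMeasure d) :=
  isFiniteMeasure_withDensity_ofReal (integrable_exp_neg_logWeight d).2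

lemma measurable_logWeight_density (d : ℕ) :
    Measurable fun x => ENNReal.ofReal (exp (-logWeight d x - 1)) := by
  have := (continuous_logWeight d).measurable
  fun_prop

lemma integral_logWeightMeasure {d : ℕ} (φ : Ed d → ℝ) :
    ∫ x, φ x ∂(logWeightMeasure d) = ∫ x, exp (-logWeight d x - 1) * φ x := by
  rw [logWeightMeasure, integral_withDensity_eq_integral_toReal_smul
    (measurable_logWeight_density d) (ae_of_all _ fun _ => ENNReal.ofReal_lt_top)]
  simp [ENNReal.toReal_ofReal (exp_pos _).le]

lemma integrable_logWeightMeasure_iff {d : ℕ} {φ : Ed d → ℝ} :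
    Integrable φ (logWeightMeasure d) ↔
      Integrable (fun x => exp (-logWeight d x - 1) * φ x) (volume : Measure (Ed d)) := by
  rw [logWeightMeasure, integrable_withDensity_iff_integrable_smul'
    (measurable_logWeight_density d) (ae_of_all _ fun _ => ENNReal.ofReal_lt_top)]
  simp [ENNReal.toReal_ofReal (exp_pos _).le]

lemma integrable_of_abs_le {α : Type*} [MeasurableSpace α] {μ : Measure α} [IsFiniteMeasure μ]
    {φ : α → ℝ} (hφ : Measurable φ) {M : ℝ} (hM : ∀ x, |φ x| ≤ M) : Integrable φ μ :=
  Integrable.of_bound hφ.aestronglyMeasurable M (ae_of_all _ hM)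

lemma integrable_exp_of_abs_le {α : Type*} [MeasurableSpace α] {μ : Measure α}
    [IsFiniteMeasure μ] {φ : α → ℝ} (hφ : Measurable φ) {M : ℝ} (hM : ∀ x, |φ x| ≤ M) :
    Integrable (fun x => exp (φ x)) μ :=
  integrable_of_abs_le (M := exp M) (by fun_prop) fun x => by
    rw [abs_of_pos (exp_pos _)]
    exact exp_le_exp.2 ((le_abs_self _).trans (hM x))

lemma WeakConv.tendsto_integral {d : ℕ} {ρs : ℕ → Measure (Ed d)} {ρ : Measure (Ed d)}
    (h : WeakConv ρs ρ) {φ : Ed d → ℝ} (hφ : Continuous φ) {M : ℝ} (hM : ∀ x, |φ x| ≤ M) :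
    Tendsto (fun n => ∫ x, φ x ∂(ρs n)) atTop (𝓝 (∫ x, φ x ∂ρ)) :=
  h (BoundedContinuousFunction.ofNormedAddCommGroup φ hφ M hM)

lemma FirstMoment.integrable_logWeight {d : ℕ} {μ : Measure (Ed d)} [IsFiniteMeasure μ]
    (h : FirstMoment μ) : Integrable (logWeight d) μ := by
  have h' : Integrable (fun x : Ed d => ‖x‖) μ := h
  refine (h'.const_mul (d + 1 : ℝ)).mono'
    (continuous_logWeight d).aestronglyMeasurable (ae_of_all _ fun x => ?_)
  rw [Real.norm_of_nonneg (logWeight_nonneg x)]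
  simpa using logWeight_le one_pos x

/-- The weight stays integrable under weak limits with bounded first moments. -/
lemma WeakConv.integrable_logWeight {d : ℕ} {C : ℝ} {ρs : ℕ → Measure (Ed d)}
    {ρ : Measure (Ed d)} [∀ n, IsProbabilityMeasure (ρs n)] [IsProbabilityMeasure ρ]
    (hmomfin : ∀ n, FirstMoment (ρs n)) (hmom : ∀ n, (∫ x, ‖x‖ ∂(ρs n)) ≤ C)
    (hconv : WeakConv ρs ρ) : Integrable (logWeight d) ρ := by
  have hV := continuous_logWeight d
  have hc : ∀ k : ℕ, Continuous fun x : Ed d => min (logWeight d x) k :=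
    fun k => hV.min continuous_const
  have h0 : ∀ (k : ℕ) (x : Ed d), 0 ≤ min (logWeight d x) k :=
    fun k x => le_min (logWeight_nonneg x) (Nat.cast_nonneg k)
  have hb : ∀ (k : ℕ) (x : Ed d), |min (logWeight d x) k| ≤ k :=
    fun k x => by rw [abs_of_nonneg (h0 k x)]; exact min_le_right _ _
  refine (integrable_and_integral_le_of_tendsto (B := (d + 1) * C)
    (F := fun (k : ℕ) x => min (logWeight d x) k) (fun k => integrable_of_abs_le
      (hc k).measurable (hb k)) h0 (fun x => ?_) fun k => ?_).1
  · refine tendsto_const_nhds.congr' ?_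
    filter_upwards [eventually_ge_atTop ⌈logWeight d x⌉₊] with k hk
    exact (min_eq_left (Nat.ceil_le.1 hk)).symm
  · refine le_of_tendsto' (hconv.tendsto_integral (hc k) (hb k)) fun n => ?_
    have hn : Integrable (fun x : Ed d => ‖x‖) (ρs n) := hmomfin n
    calc ∫ x, min (logWeight d x) k ∂(ρs n) ≤ ∫ x, (d + 1 : ℝ) * ‖x‖ ∂(ρs n) := by
          refine integral_mono (integrable_of_abs_le (hc k).measurable (hb k))
            (hn.const_mul _) fun x => (min_le_left _ _).trans ?_
          simpa using logWeight_le one_pos x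
      _ ≤ (d + 1) * C := by
          rw [integral_const_mul]
          exact mul_le_mul_of_nonneg_left (hmom n) (by positivity)

/-- Dual lower bound on the inferior limit of the entropies, for continuous test functions. -/
lemma WeakConv.dual_le_liminf_entropy_of_continuous {d : ℕ} {C : ℝ} (hC : 0 < C)
    {ρs : ℕ → Measure (Ed d)}
    {ρ : Measure (Ed d)} [∀ n, IsProbabilityMeasure (ρs n)] [IsProbabilityMeasure ρ]
    (hmomfin : ∀ n, FirstMoment (ρs n)) (hmom : ∀ n, (∫ x, ‖x‖ ∂(ρs n)) ≤ C)
    (hconv : WeakConv ρs ρ) {φ : Ed d → ℝ} (hφ : Continuous φ) {M : ℝ} (hM : ∀ x, |φ x| ≤ M) :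
    ((∫ x, φ x ∂ρ - ∫ x, logWeight d x ∂ρ - ∫ x, exp (φ x) ∂(logWeightMeasure d) : ℝ) : EReal)
      ≤ liminf (fun n => entropy (ρs n)) atTop := by
  have hV := continuous_logWeight d
  have hVρ : Integrable (logWeight d) ρ := hconv.integrable_logWeight hmomfin hmom
  set K : ℝ := ∫ x, exp (φ x) ∂(logWeightMeasure d) with hK
  have hexp : Integrable (fun x => exp (φ x - logWeight d x - 1)) (volume : Measure (Ed d)) := by
    refine (integrable_logWeightMeasure_iff.1
      (integrable_exp_of_abs_le hφ.measurable hM)).congr (ae_of_all _ fun x => ?_)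
    simp only [← exp_add]
    ring_nf
  have hKeq : ∫ x, exp (φ x - logWeight d x - 1) = K := by
    rw [hK, integral_logWeightMeasure]
    refine integral_congr_ae (ae_of_all _ fun x => ?_)
    simp only [← exp_add]
    ring_nf
  refine EReal.le_of_forall_lt_iff_le.1 fun z hz => EReal.coe_le_coe_iff.2 ?_
  by_contra! hlt
  set ε : ℝ := ∫ x, φ x ∂ρ - ∫ x, logWeight d x ∂ρ - K - z with hε
  have hε0 : 0 < ε := by linarith
  obtain ⟨δ, hδ, hδε⟩ : ∃ δ : ℝ, 0 < δ ∧ (d + 1) * δ * C = ε :=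
    ⟨ε / ((d + 1) * C), by positivity, by field_simp⟩
  set R : ℝ := (d + 1) * (δ - log δ - 1) with hR
  have hR0 : 0 ≤ R := mul_nonneg (by positivity) (by linarith [log_le_sub_one_of_pos hδ])
  have hmin : Continuous fun x : Ed d => min (logWeight d x) R := hV.min continuous_const
  have hminb : ∀ x : Ed d, |min (logWeight d x) R| ≤ R := fun x => by
    rw [abs_of_nonneg (le_min (logWeight_nonneg x) hR0)]
    exact min_le_right _ _
  have hlim : Tendsto (fun n => ∫ x, φ x ∂(ρs n) - ∫ x, min (logWeight d x) R ∂(ρs n) - ε - K)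
      atTop (𝓝 (∫ x, φ x ∂ρ - ∫ x, min (logWeight d x) R ∂ρ - ε - K)) :=
    (((hconv.tendsto_integral hφ hM).sub
      (hconv.tendsto_integral hmin hminb)).sub_const ε).sub_const K
  have hle : ∫ x, min (logWeight d x) R ∂ρ ≤ ∫ x, logWeight d x ∂ρ :=
    integral_mono (integrable_of_abs_le hmin.measurable hminb) hVρ fun x => min_le_left _ _
  have hn : ∀ n, ((∫ x, φ x ∂(ρs n) - ∫ x, min (logWeight d x) R ∂(ρs n) - ε - K : ℝ) : EReal)
      ≤ entropy (ρs n) := fun n => by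
    have hVn := (hmomfin n).integrable_logWeight
    have hφn : Integrable φ (ρs n) := integrable_of_abs_le hφ.measurable hM
    have hminn := integrable_of_abs_le (μ := ρs n) hmin.measurable hminb
    have hnn : Integrable (fun x : Ed d => ‖x‖) (ρs n) := hmomfin n
    have hent := integral_sub_integral_exp_le_entropy (ρs n) (hφn.sub hVn) hexp
    simp only [Pi.sub_apply] at hent
    rw [hKeq, integral_sub hφn hVn] at hent
    refine (EReal.coe_le_coe_iff.2 ?_).trans hent
    have hV' : ∫ x, logWeight d x ∂(ρs n) ≤
        ∫ x, min (logWeight d x) R + (d + 1) * δ * ‖x‖ ∂(ρs n) := by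
      refine integral_mono hVn (hminn.add (hnn.const_mul _)) fun x => ?_
      have h1 := logWeight_le hδ x
      have h2 : 0 ≤ (d + 1) * δ * ‖x‖ := by positivity
      rcases min_cases (logWeight d x) R with h | h <;> simp only [h.1] <;> linarith
    rw [integral_add hminn (hnn.const_mul _), integral_const_mul] at hV'
    have h3 := mul_le_mul_of_nonneg_left (hmom n) (by positivity : 0 ≤ (d + 1) * δ)
    linarith
  have key : ((∫ x, φ x ∂ρ - ∫ x, min (logWeight d x) R ∂ρ - ε - K : ℝ) : EReal)
      ≤ liminf (fun n => entropy (ρs n)) atTop := by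
    rw [← ((continuous_coe_real_ereal.tendsto _).comp hlim).liminf_eq]
    exact liminf_le_liminf (Eventually.of_forall hn)
  have := EReal.coe_lt_coe_iff.1 (key.trans_lt hz)
  linarith

/-- A bounded measurable function is a limit in mean of equally bounded continuous functions. -/
lemma exists_continuous_abs_le_integral_sub_le {d : ℕ} (μ : Measure (Ed d)) [IsFiniteMeasure μ]
    {φ : Ed d → ℝ} (hφ : Measurable φ) {M : ℝ} (hM : ∀ x, |φ x| ≤ M) {ε : ℝ} (hε : 0 < ε) :
    ∃ ψ : Ed d → ℝ, Continuous ψ ∧ (∀ x, |ψ x| ≤ M) ∧ ∫ x, |φ x - ψ x| ∂μ ≤ ε := by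
  obtain ⟨g, hg, hgi⟩ :=
    (integrable_of_abs_le (μ := μ) hφ hM).exists_boundedContinuous_integral_sub_le hε
  have hM0 : -M ≤ M := by linarith [(abs_nonneg _).trans (hM 0)]
  refine ⟨fun x => max (-M) (min M (g x)), by fun_prop, fun x => abs_le.2
    ⟨le_max_left _ _, max_le hM0 (min_le_left _ _)⟩, le_trans ?_ hg⟩
  refine integral_mono_of_nonneg (ae_of_all _ fun x => abs_nonneg _)
    ((integrable_of_abs_le hφ hM).sub hgi).norm (ae_of_all _ fun x => ?_)
  have hx := abs_le.1 (hM x)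
  simp only [Real.norm_eq_abs]
  calc |φ x - max (-M) (min M (g x))|
      = |max (-M) (min M (φ x)) - max (-M) (min M (g x))| := by
        rw [min_eq_right hx.2, max_eq_right hx.1]
    _ ≤ |min M (φ x) - min M (g x)| := by
        simpa [max_comm] using abs_max_sub_max_le_abs (min M (φ x)) (min M (g x)) (-M)
    _ ≤ |φ x - g x| := by
        simpa [min_comm] using abs_min_sub_min_le_max (φ x) M (g x) M

lemma abs_exp_sub_exp_le {a b M : ℝ} (ha : a ≤ M) (hb : b ≤ M) :
    |exp a - exp b| ≤ exp M * |a - b| := by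
  wlog h : b ≤ a generalizing a b
  · rw [abs_sub_comm, abs_sub_comm a]
    exact this hb ha (le_of_not_ge h)
  rw [abs_of_nonneg (sub_nonneg.2 (exp_le_exp.2 h)), abs_of_nonneg (sub_nonneg.2 h)]
  have h1 := add_one_le_exp (b - a)
  have h2 : exp b = exp a * exp (b - a) := by rw [← exp_add]; ring_nf
  have h3 : exp a * (a - b) ≤ exp M * (a - b) :=
    mul_le_mul_of_nonneg_right (exp_le_exp.2 ha) (sub_nonneg.2 h)
  have h4 := mul_le_mul_of_nonneg_left h1 (exp_pos a).le
  rw [h2]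
  linarith

/-- Dual lower bound on the inferior limit of the entropies, for measurable test functions. -/
lemma WeakConv.dual_le_liminf_entropy {d : ℕ} {C : ℝ} (hC : 0 < C)
    {ρs : ℕ → Measure (Ed d)}
    {ρ : Measure (Ed d)} [∀ n, IsProbabilityMeasure (ρs n)] [IsProbabilityMeasure ρ]
    (hmomfin : ∀ n, FirstMoment (ρs n)) (hmom : ∀ n, (∫ x, ‖x‖ ∂(ρs n)) ≤ C)
    (hconv : WeakConv ρs ρ) {φ : Ed d → ℝ} (hφ : Measurable φ) {M : ℝ} (hM : ∀ x, |φ x| ≤ M) :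
    ((∫ x, φ x ∂ρ - ∫ x, logWeight d x ∂ρ - ∫ x, exp (φ x) ∂(logWeightMeasure d) : ℝ) : EReal)
      ≤ liminf (fun n => entropy (ρs n)) atTop := by
  refine EReal.le_of_forall_lt_iff_le.1 fun z hz => EReal.coe_le_coe_iff.2 ?_
  by_contra! hlt
  set γ := logWeightMeasure d
  set ε : ℝ := ∫ x, φ x ∂ρ - ∫ x, logWeight d x ∂ρ - ∫ x, exp (φ x) ∂γ - z with hε
  have hε0 : 0 < ε := by linarith
  obtain ⟨δ, hδ, hδε⟩ : ∃ δ : ℝ, 0 < δ ∧ δ + exp M * δ = ε :=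
    ⟨ε / (1 + exp M), by positivity, by field_simp⟩
  obtain ⟨ψ, hψ, hψM, hφψ⟩ := exists_continuous_abs_le_integral_sub_le (ρ + γ) hφ hM hδ
  have hmeas : Measurable fun x => |φ x - ψ x| := by
    have := hψ.measurable
    fun_prop
  have hb : ∀ x, |(|φ x - ψ x|)| ≤ M + M := fun x => by
    rw [abs_abs]
    exact (abs_sub _ _).trans (add_le_add (hM x) (hψM x))
  have hρ := integrable_of_abs_le (μ := ρ) hmeas hb
  have hγ := integrable_of_abs_le (μ := γ) hmeas hb
  rw [integral_add_measure hρ hγ] at hφψ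
  have h0ρ : 0 ≤ ∫ x, |φ x - ψ x| ∂ρ := integral_nonneg fun x => abs_nonneg _
  have h0γ : 0 ≤ ∫ x, |φ x - ψ x| ∂γ := integral_nonneg fun x => abs_nonneg _
  have h1 : ∫ x, φ x ∂ρ - ∫ x, ψ x ∂ρ ≤ δ := by
    rw [← integral_sub (integrable_of_abs_le hφ hM) (integrable_of_abs_le hψ.measurable hψM)]
    have := (le_abs_self _).trans (abs_integral_le_integral_abs (μ := ρ) (f := fun x => φ x - ψ x))
    linarith
  have h2 : ∫ x, exp (ψ x) ∂γ - ∫ x, exp (φ x) ∂γ ≤ exp M * δ := by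
    have he1 := integrable_exp_of_abs_le (μ := γ) hψ.measurable hψM
    have he2 := integrable_exp_of_abs_le (μ := γ) hφ hM
    rw [← integral_sub he1 he2]
    calc ∫ x, exp (ψ x) - exp (φ x) ∂γ ≤ ∫ x, exp M * |φ x - ψ x| ∂γ := by
          refine integral_mono (he1.sub he2) (hγ.const_mul _) fun x => ?_
          rw [abs_sub_comm]
          exact (le_abs_self _).trans (abs_exp_sub_exp_le ((le_abs_self _).trans (hψM x))
            ((le_abs_self _).trans (hM x)))
      _ ≤ exp M * δ := by
          rw [integral_const_mul]
          exact mul_le_mul_of_nonneg_left (by linarith) (exp_pos M).le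
  have := EReal.coe_lt_coe_iff.1
    ((hconv.dual_le_liminf_entropy_of_continuous hC hmomfin hmom hψ hψM).trans_lt hz)
  linarith

/-- The truncation of `t` to the interval `[1 / (k + 1), k + 1]`. -/
def truncPos (k : ℕ) (t : ℝ) : ℝ := max ((k + 1 : ℝ)⁻¹) (min t (k + 1))

lemma truncPos_pos (k : ℕ) (t : ℝ) : 0 < truncPos k t :=
  lt_max_of_lt_left (by positivity)

lemma abs_log_truncPos_le (k : ℕ) (t : ℝ) : |log (truncPos k t)| ≤ log (k + 1) := by
  have hk : (0 : ℝ) < k + 1 := by positivity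
  have hk1 : (k + 1 : ℝ)⁻¹ ≤ k + 1 := (inv_le_one_of_one_le₀ (by simp)).trans (by simp)
  rw [abs_le, ← log_inv]
  exact ⟨log_le_log (by positivity) (le_max_left _ _),
    log_le_log (truncPos_pos k t) (max_le hk1 (min_le_right _ _))⟩

lemma mul_log_truncPos_nonneg (k : ℕ) (t : ℝ) :
    0 ≤ t * log (truncPos k t) - truncPos k t + 1 := by
  have hc := truncPos_pos k t
  have hk1 : (k + 1 : ℝ)⁻¹ ≤ 1 := inv_le_one_of_one_le₀ (by simp)
  have hk : (1 : ℝ) ≤ k + 1 := by simp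
  have h : 0 ≤ (t - truncPos k t) * log (truncPos k t) := by
    rcases le_total 1 (truncPos k t) with h | h
    · rcases le_or_gt (truncPos k t) t with h' | h'
      · exact mul_nonneg (sub_nonneg.2 h') (log_nonneg h)
      · have : truncPos k t = 1 := by
          unfold truncPos at *
          grind
        simp [this]
    · rcases le_or_gt t (truncPos k t) with h' | h'
      · exact mul_nonneg_of_nonpos_of_nonpos (sub_nonpos.2 h') (log_nonpos hc.le h)
      · have : truncPos k t = 1 := by
          unfold truncPos at *
          grind
        simp [this]
  linarith [mul_log_sub_add_one_nonneg hc]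

lemma tendsto_truncPos {t : ℝ} (ht : 0 ≤ t) :
    Tendsto (fun k => truncPos k t) atTop (𝓝 t) := by
  have h1 : Tendsto (fun k : ℕ => ((k : ℝ) + 1)⁻¹) atTop (𝓝 0) := by
    simpa using tendsto_one_div_add_atTop_nhds_zero_nat (𝕜 := ℝ)
  have h2 : Tendsto (fun k : ℕ => min t ((k : ℝ) + 1)) atTop (𝓝 t) := by
    refine tendsto_const_nhds.congr' ?_
    filter_upwards [eventually_ge_atTop ⌈t⌉₊] with k hk
    exact (min_eq_left ((Nat.ceil_le.1 hk).trans (by simp))).symm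
  simpa [truncPos, max_eq_right ht] using h1.max h2

lemma tendsto_mul_log_truncPos {t : ℝ} (ht : 0 ≤ t) :
    Tendsto (fun k => t * log (truncPos k t) - truncPos k t + 1) atTop
      (𝓝 (t * log t - t + 1)) := by
  refine Tendsto.add_const 1 (Tendsto.sub ?_ (tendsto_truncPos ht))
  rcases ht.eq_or_lt with rfl | ht'
  · simp
  · exact ((tendsto_truncPos ht).log ht'.ne').const_mul t

/-- If the measure `ρ` satisfies every dual bound with constant `L`, then it has a density. -/
lemma absolutelyContinuous_of_dual_le {d : ℕ} {ρ : Measure (Ed d)} [IsFiniteMeasure ρ] {L : ℝ}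
    (hL : ∀ φ : Ed d → ℝ, Measurable φ → ∀ M, (∀ x, |φ x| ≤ M) →
      ∫ x, φ x ∂ρ - ∫ x, logWeight d x ∂ρ - ∫ x, exp (φ x) ∂(logWeightMeasure d) ≤ L) :
    ρ ≪ (volume : Measure (Ed d)) := by
  refine Measure.AbsolutelyContinuous.mk fun s hs hs0 => ?_
  by_contra hne
  have hpos : 0 < ρ.real s := (ENNReal.toReal_pos hne (measure_ne_top ρ s))
  set γ := logWeightMeasure d
  have hγs : γ s = 0 := withDensity_absolutelyContinuous _ _ hs0
  obtain ⟨k, hk⟩ := exists_nat_gt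
    ((L + ∫ x, logWeight d x ∂ρ + ∫ _, (1 : ℝ) ∂γ) / ρ.real s)
  rw [div_lt_iff₀ hpos] at hk
  have h := hL (s.indicator fun _ => (k : ℝ)) (measurable_const.indicator hs) k fun x => by
    by_cases hx : x ∈ s <;> simp [hx]
  rw [integral_indicator_const _ hs, smul_eq_mul] at h
  have hexp : ∫ x, exp (s.indicator (fun _ => (k : ℝ)) x) ∂γ = ∫ _, (1 : ℝ) ∂γ := by
    refine integral_congr_ae ?_
    filter_upwards [measure_eq_zero_iff_ae_notMem.1 hγs] with x hx
    simp [hx]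
  rw [hexp] at h
  linarith [mul_comm (k : ℝ) (ρ.real s)]

/-- If the measure `ρ` satisfies every dual bound with constant `L`, then its entropy is at
most `L`. -/
lemma entropy_le_of_dual_le {d : ℕ} {ρ : Measure (Ed d)} [IsFiniteMeasure ρ] {L : ℝ}
    (hV : Integrable (logWeight d) ρ)
    (hL : ∀ φ : Ed d → ℝ, Measurable φ → ∀ M, (∀ x, |φ x| ≤ M) →
      ∫ x, φ x ∂ρ - ∫ x, logWeight d x ∂ρ - ∫ x, exp (φ x) ∂(logWeightMeasure d) ≤ L) :
    entropy ρ ≤ (L : EReal) := by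
  have hac := absolutelyContinuous_of_dual_le hL
  have hVm := (continuous_logWeight d).measurable
  set f : Ed d → ℝ := fun x => (ρ.rnDeriv volume x).toReal with hf
  have hfm : Measurable f := (Measure.measurable_rnDeriv _ _).ennreal_toReal
  have hf0 : ∀ x, 0 ≤ f x := fun x => ENNReal.toReal_nonneg
  set w : Ed d → ℝ := fun x => exp (-logWeight d x - 1) with hw
  have hw0 : ∀ x, 0 < w x := fun x => exp_pos _
  have hwi : Integrable w volume := integrable_exp_neg_logWeight d
  set h : Ed d → ℝ := fun x => f x / w x with hh
  have hwm : Measurable w := by fun_prop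
  have hhm : Measurable h := hfm.div hwm
  have hh0 : ∀ x, 0 ≤ h x := fun x => div_nonneg (hf0 x) (hw0 x).le
  have hwh : ∀ x, w x * h x = f x := fun x => mul_div_cancel₀ _ (hw0 x).ne'
  set φ : ℕ → Ed d → ℝ := fun k x => log (truncPos k (h x)) with hφ
  have hφm : ∀ k, Measurable (φ k) := fun k => by
    simp only [hφ, truncPos]
    fun_prop
  have hφb : ∀ k x, |φ k x| ≤ log (k + 1) := fun k x => abs_log_truncPos_le _ _
  have hexpφ : ∀ k x, exp (φ k x) = truncPos k (h x) := fun k x => exp_log (truncPos_pos _ _)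
  have hfV : Integrable (fun x => f x * logWeight d x) volume :=
    (integrable_toReal_rnDeriv_mul_iff hac).2 hV
  have hfVeq : ∫ x, f x * logWeight d x = ∫ x, logWeight d x ∂ρ :=
    integral_toReal_rnDeriv_mul hac
  have hFeq : ∀ k x, w x * (h x * log (truncPos k (h x)) - truncPos k (h x) + 1) =
      f x * φ k x - w x * exp (φ k x) + w x := fun k x => by
    rw [hexpφ, ← hwh x]; ring
  have hfφ : ∀ k, Integrable (fun x => f x * φ k x) volume := fun k =>
    (integrable_toReal_rnDeriv_mul_iff hac).2 (integrable_of_abs_le (hφm k) (hφb k))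
  have hwφ : ∀ k, Integrable (fun x => w x * exp (φ k x)) volume := fun k =>
    integrable_logWeightMeasure_iff.1 (integrable_exp_of_abs_le (hφm k) (hφb k))
  have hsub : ∀ k, Integrable (fun x => f x * φ k x - w x * exp (φ k x)) volume :=
    fun k => (hfφ k).sub (hwφ k)
  obtain ⟨hGi, hGle⟩ := integrable_and_integral_le_of_tendsto (μ := (volume : Measure (Ed d)))
    (F := fun k x => w x * (h x * log (truncPos k (h x)) - truncPos k (h x) + 1))
    (G := fun x => w x * (h x * log (h x) - h x + 1))
    (B := L + ∫ x, logWeight d x ∂ρ + ∫ x, w x)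
    (fun k => by simp only [hFeq]; exact (hsub k).add hwi)
    (fun k x => mul_nonneg (hw0 x).le (mul_log_truncPos_nonneg _ _))
    (fun x => (tendsto_mul_log_truncPos (hh0 x)).const_mul _)
    (fun k => by
      simp only [hFeq]
      rw [integral_add (hsub k) hwi, integral_sub (hfφ k) (hwφ k),
        integral_toReal_rnDeriv_mul hac, ← integral_logWeightMeasure]
      linarith [hL (φ k) (hφm k) _ (hφb k)])
  have hGeq : ∀ x, w x * (h x * log (h x) - h x + 1) =
      f x * log (f x) + f x * logWeight d x + w x := fun x => by
    rcases (hf0 x).eq_or_lt with h0 | h0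
    · simp [hh, ← h0]
    · have hlog : log (h x) = log (f x) + logWeight d x + 1 := by
        rw [hh, log_div h0.ne' (hw0 x).ne', hw, log_exp]; ring
      rw [hlog, ← hwh x]; ring
  simp only [hGeq] at hGi hGle
  have hflog : Integrable (fun x => f x * log (f x)) volume := by
    refine ((hGi.sub hfV).sub hwi).congr (ae_of_all _ fun x => ?_)
    simp only [Pi.sub_apply]
    ring
  have hadd : Integrable (fun x => f x * log (f x) + f x * logWeight d x) volume :=
    hflog.add hfV
  rw [integral_add hadd hwi, integral_add hflog hfV, hfVeq] at hGle
  rw [entropy, if_pos hac, ← EReal.coe_integral_eq_lintegral_sub hflog, EReal.coe_le_coe_iff]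
  linarith

/-- lower semicontinuity of the entropy along weakly converging sequences with
bounded first moments and bounded entropies. -/
theorem entropy_lsc {d : ℕ} (hd : 1 ≤ d) (C : ℝ) (hC : 0 < C)
    (ρs : ℕ → Measure (Ed d)) (ρ : Measure (Ed d))
    [∀ n, IsProbabilityMeasure (ρs n)] [IsProbabilityMeasure ρ]
    (hmomfin : ∀ n, FirstMoment (ρs n))
    (hmom : ∀ n, (∫ x, ‖x‖ ∂(ρs n)) ≤ C)
    (hent : ∀ n, entropy (ρs n) ≤ (C : EReal))
    (hconv : WeakConv ρs ρ) :
    entropy ρ ≤ liminf (fun n => entropy (ρs n)) atTop := by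
  have hdual := fun φ hφ M hM =>
    hconv.dual_le_liminf_entropy hC hmomfin hmom (φ := φ) hφ (M := M) hM
  generalize liminf (fun n => entropy (ρs n)) atTop = l at hdual ⊢
  induction l with
  | bot => exact absurd (hdual 0 measurable_const 0 (by simp)) (EReal.bot_lt_coe _).not_ge
  | top => exact le_top
  | coe L =>
    exact entropy_le_of_dual_le (hconv.integrable_logWeight hmomfin hmom)
      fun φ hφ M hM => EReal.coe_le_coe_iff.1 (hdual φ hφ M hM)
end
end

section
/- Let d ≥ 1 and let μ ∈ P_1(ℝ^d) be centered. Then there exists a sequence μ_n of compactly supported, centered Borel probability measures on ℝ^d converging weakly to μ such that for every ρ ∈ P_1(ℝ^d) one has T(ρ,μ_n) → T(ρ,μ) (convergence in [0,+∞]). -/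
open MeasureTheory Real Filter Topology
open scoped ENNReal RealInnerProductSpace

noncomputable section

lemma FirstMoment.integrable {d : ℕ} {ρ : Measure (Ed d)} (h : FirstMoment ρ) :
    Integrable (fun x => x) ρ :=
  (integrable_norm_iff aestronglyMeasurable_id).1 h

lemma pairInt_eq_integral {d : ℕ} {γ : Measure (Ed d × Ed d)}
    (h : Integrable (fun p => (⟪p.1, p.2⟫ : ℝ)) γ) :
    pairInt γ = ((∫ p, (⟪p.1, p.2⟫ : ℝ) ∂γ : ℝ) : EReal) := by
  have h' : Integrable (fun p : Ed d × Ed d => -(⟪p.1, p.2⟫ : ℝ)) γ := h.neg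
  rw [integral_eq_lintegral_pos_part_sub_lintegral_neg_part h, pairInt, EReal.coe_sub,
    EReal.coe_ennreal_toReal h.lintegral_lt_top.ne,
    EReal.coe_ennreal_toReal h'.lintegral_lt_top.ne]

lemma pairInt_le_maxCorr {d : ℕ} {ρ μ : Measure (Ed d)} {γ : Measure (Ed d × Ed d)}
    (h : γ ∈ Couplings ρ μ) : pairInt γ ≤ maxCorr ρ μ :=
  le_iSup₂ (f := fun γ _ => pairInt γ) γ h

/-- Completing a partial coupling by the normalised product of the leftover marginals. -/
lemma add_prod_mem_couplings {d : ℕ} {ρ μ : Measure (Ed d)} [IsProbabilityMeasure ρ]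
    {lam : Measure (Ed d × Ed d)} {α β : Measure (Ed d)} [IsFiniteMeasure α] [IsFiniteMeasure β]
    (h1 : lam.fst + α = ρ) (h2 : lam.snd + β = μ) (hm : α Set.univ = β Set.univ) :
    lam + (α Set.univ)⁻¹ • α.prod β ∈ Couplings ρ μ := by
  have key1 : ((α Set.univ)⁻¹ • α.prod β).fst = α := by
    rw [Measure.fst, Measure.map_smul, Measure.map_fst_prod, ← hm, smul_smul]
    by_cases h : α Set.univ = 0
    · rw [Measure.measure_univ_eq_zero.1 h]; simp
    · rw [ENNReal.inv_mul_cancel h (measure_ne_top _ _), one_smul]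
  have key2 : ((α Set.univ)⁻¹ • α.prod β).snd = β := by
    rw [Measure.snd, Measure.map_smul, Measure.map_snd_prod, smul_smul]
    by_cases h : α Set.univ = 0
    · rw [Measure.measure_univ_eq_zero.1 (hm.symm.trans h)]; simp
    · rw [ENNReal.inv_mul_cancel h (measure_ne_top _ _), one_smul]
  have hf : (lam + (α Set.univ)⁻¹ • α.prod β).fst = ρ := by rw [Measure.fst_add, key1, h1]
  refine ⟨⟨?_⟩, hf, by rw [Measure.snd_add, key2, h2]⟩
  rw [← Measure.fst_univ, hf, measure_univ]

lemma integrable_inner_prod {d : ℕ} {α β : Measure (Ed d)} [IsFiniteMeasure α] [IsFiniteMeasure β]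
    (hα : Integrable (fun x => x) α) (hβ : Integrable (fun x => x) β) :
    Integrable (fun p : Ed d × Ed d => (⟪p.1, p.2⟫ : ℝ)) (α.prod β) := by
  refine (hα.norm.mul_prod hβ.norm).mono' (by fun_prop) (ae_of_all _ fun p => ?_)
  exact norm_inner_le_norm _ _

lemma integral_inner_prod {d : ℕ} {α β : Measure (Ed d)} [IsFiniteMeasure α] [IsFiniteMeasure β]
    (hα : Integrable (fun x => x) α) (hβ : Integrable (fun x => x) β) :
    ∫ p : Ed d × Ed d, (⟪p.1, p.2⟫ : ℝ) ∂(α.prod β) = ⟪∫ x, x ∂α, ∫ y, y ∂β⟫ := by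
  rw [integral_prod _ (integrable_inner_prod hα hβ)]
  simp_rw [integral_inner hβ, real_inner_comm (∫ y, y ∂β)]
  rw [integral_inner hα, real_inner_comm]

lemma coe_le_maxCorr_of_add_prod {d : ℕ} {ρ μ : Measure (Ed d)} [IsProbabilityMeasure ρ]
    {lam : Measure (Ed d × Ed d)} {α β : Measure (Ed d)} [IsFiniteMeasure α] [IsFiniteMeasure β]
    (h1 : lam.fst + α = ρ) (h2 : lam.snd + β = μ) (hm : α Set.univ = β Set.univ)
    (hlam : Integrable (fun p => (⟪p.1, p.2⟫ : ℝ)) lam)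
    (hα : Integrable (fun x => x) α) (hβ : Integrable (fun x => x) β) :
    ((∫ p, (⟪p.1, p.2⟫ : ℝ) ∂lam + (α.real Set.univ)⁻¹ * ⟪∫ x, x ∂α, ∫ y, y ∂β⟫ : ℝ) : EReal)
      ≤ maxCorr ρ μ := by
  have hp : Integrable (fun p => (⟪p.1, p.2⟫ : ℝ)) ((α Set.univ)⁻¹ • α.prod β) := by
    by_cases h : α Set.univ = 0
    · rw [Measure.measure_univ_eq_zero.1 h]; simp
    · exact (integrable_inner_prod hα hβ).smul_measure (ENNReal.inv_ne_top.2 h)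
  refine le_trans (le_of_eq ?_) (pairInt_le_maxCorr (add_prod_mem_couplings h1 h2 hm))
  rw [pairInt_eq_integral (hlam.add_measure hp), integral_add_measure hlam hp,
    integral_smul_measure, integral_inner_prod hα hβ, ENNReal.toReal_inv, smul_eq_mul]
  rfl

lemma integrable_fst_of_mem_couplings {d : ℕ} {ρ μ : Measure (Ed d)} {γ : Measure (Ed d × Ed d)}
    (h : γ ∈ Couplings ρ μ) (hρ : FirstMoment ρ) : Integrable (fun p : Ed d × Ed d => p.1) γ := by
  have := hρ.integrable
  rw [← h.2.1, Measure.fst] at this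
  exact this.comp_measurable measurable_fst

lemma integrable_inner_of_bounded {d : ℕ} {γ : Measure (Ed d × Ed d)} {R : ℝ}
    (h1 : Integrable (fun p : Ed d × Ed d => p.1) γ) (hR : ∀ᵐ p ∂γ, ‖p.2‖ ≤ R) :
    Integrable (fun p : Ed d × Ed d => (⟪p.1, p.2⟫ : ℝ)) γ := by
  refine (h1.norm.mul_const R).mono' (by fun_prop) ?_
  filter_upwards [hR] with p hp
  exact (norm_inner_le_norm _ _).trans (by gcongr)

open Classical in
/-- The map which is the identity on `B` and sends the complement of `B` to its `μ`-barycenter. -/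
def tailCollapse {d : ℕ} (μ : Measure (Ed d)) (B : Set (Ed d)) : Ed d → Ed d :=
  B.piecewise id fun _ => ⨍ y in Bᶜ, y ∂μ

section Collapse

variable {d : ℕ} {μ : Measure (Ed d)} {B : Set (Ed d)}

lemma tailCollapse_of_mem {y : Ed d} (h : y ∈ B) : tailCollapse μ B y = y := by
  simp [tailCollapse, h]

lemma tailCollapse_of_notMem {y : Ed d} (h : y ∉ B) : tailCollapse μ B y = ⨍ y in Bᶜ, y ∂μ := by
  simp [tailCollapse, h]

lemma measurable_tailCollapse (hB : MeasurableSet B) : Measurable (tailCollapse μ B) := by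
  classical
  exact Measurable.piecewise hB measurable_id measurable_const

lemma norm_tailCollapse_le {R : ℝ} (hR : ∀ y ∈ B, ‖y‖ ≤ R) (y : Ed d) :
    ‖tailCollapse μ B y‖ ≤ max R ‖⨍ y in Bᶜ, y ∂μ‖ := by
  by_cases h : y ∈ B
  · rw [tailCollapse_of_mem h]; exact le_max_of_le_left (hR y h)
  · rw [tailCollapse_of_notMem h]; exact le_max_right _ _

lemma integrable_tailCollapse [IsFiniteMeasure μ] (hB : MeasurableSet B) {R : ℝ}
    (hR : ∀ y ∈ B, ‖y‖ ≤ R) : Integrable (tailCollapse μ B) μ :=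
  .of_bound (measurable_tailCollapse hB).aestronglyMeasurable _ (ae_of_all _ (norm_tailCollapse_le hR))

lemma setIntegral_compl_tailCollapse [IsFiniteMeasure μ] (hB : MeasurableSet B) :
    ∫ y in Bᶜ, tailCollapse μ B y ∂μ = ∫ y in Bᶜ, y ∂μ := by
  rw [setIntegral_congr_fun (g := fun _ => ⨍ y in Bᶜ, y ∂μ) hB.compl
    fun y hy => tailCollapse_of_notMem hy, setIntegral_const,
    measure_smul_setAverage _ (measure_ne_top _ _)]

/-- Collapsing preserves the barycenter of every set containing the tailCollapsed region. -/
lemma setIntegral_tailCollapse [IsFiniteMeasure μ] (hB : MeasurableSet B) {R : ℝ}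
    (hR : ∀ y ∈ B, ‖y‖ ≤ R) (hμ : FirstMoment μ) {A : Set (Ed d)}
    (hAm : MeasurableSet A) (hA : Bᶜ ⊆ A) :
    ∫ y in A, tailCollapse μ B y ∂μ = ∫ y in A, y ∂μ := by
  have h := (integrable_tailCollapse (μ := μ) hB hR).integrableOn (s := A)
  have e : ∀ f : Ed d → Ed d, IntegrableOn f A μ →
      ∫ y in A, f y ∂μ = ∫ y in A ∩ B, f y ∂μ + ∫ y in Bᶜ, f y ∂μ := fun f hf => by
    rw [← integral_inter_add_sdiff hB hf, Set.sdiff_eq, Set.inter_eq_right.2 hA]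
  rw [e _ h, e _ hμ.integrable.integrableOn, setIntegral_compl_tailCollapse hB]
  congr 1
  exact setIntegral_congr_fun (hAm.inter hB) fun y hy => tailCollapse_of_mem hy.2

end Collapse

lemma fst_restrict_compl_add {d : ℕ} {γ : Measure (Ed d × Ed d)} {S : Set (Ed d × Ed d)}
    (hS : MeasurableSet S) : (γ.restrict Sᶜ).fst + (γ.restrict S).fst = γ.fst := by
  rw [← Measure.fst_add, Measure.restrict_compl_add_restrict hS]

lemma snd_restrict_preimage {d : ℕ} {γ : Measure (Ed d × Ed d)} {B : Set (Ed d)}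
    (hB : MeasurableSet B) : (γ.restrict (Prod.snd ⁻¹' B)).snd = γ.snd.restrict B := by
  rw [Measure.snd, Measure.snd, Measure.restrict_map measurable_snd hB]

lemma integrable_fst_marginal {d : ℕ} {γ : Measure (Ed d × Ed d)}
    (h : Integrable (fun p : Ed d × Ed d => p.1) γ) : Integrable (fun x => x) γ.fst :=
  (integrable_map_measure (g := fun x : Ed d => x) aestronglyMeasurable_id
    measurable_fst.aemeasurable).2 h

lemma integral_fst_marginal {d : ℕ} (γ : Measure (Ed d × Ed d)) :
    ∫ x, x ∂γ.fst = ∫ p : Ed d × Ed d, p.1 ∂γ :=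
  integral_map (f := fun x : Ed d => x) measurable_fst.aemeasurable aestronglyMeasurable_id

lemma map_tailCollapse_restrict {d : ℕ} {μ : Measure (Ed d)} {B A : Set (Ed d)}
    (hA : MeasurableSet A) (h : A ⊆ B) :
    (μ.restrict A).map (tailCollapse μ B) = μ.restrict A := by
  have : tailCollapse μ B =ᵐ[μ.restrict A] id :=
    (ae_restrict_iff' hA).2 (ae_of_all _ fun y hy => tailCollapse_of_mem (h hy))
  rw [Measure.map_congr this, Measure.map_id]

/-- Replacing the tail of `μ` by its barycenter decreases the maximal correlation. -/
lemma maxCorr_map_tailCollapse_le {d : ℕ} {ρ μ : Measure (Ed d)} [IsProbabilityMeasure ρ]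
    [IsProbabilityMeasure μ] (hρ : FirstMoment ρ) (hμ : FirstMoment μ) {B : Set (Ed d)}
    (hB : MeasurableSet B) {R : ℝ} (hR : ∀ y ∈ B, ‖y‖ ≤ R) :
    maxCorr ρ (μ.map (tailCollapse μ B)) ≤ maxCorr ρ μ := by
  refine iSup₂_le fun γ hγ => ?_
  have := hγ.1
  have hT := measurable_tailCollapse (μ := μ) hB
  set T := tailCollapse μ B
  set c := ⨍ y in Bᶜ, y ∂μ
  set S : Set (Ed d × Ed d) := Prod.snd ⁻¹' {c} with hSdef
  have hS : MeasurableSet S := measurable_snd (measurableSet_singleton c)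
  set A := T ⁻¹' {c}
  have hA : MeasurableSet A := hT (measurableSet_singleton c)
  have hBA : Bᶜ ⊆ A := fun y hy => tailCollapse_of_notMem hy
  have h1 := integrable_fst_of_mem_couplings hγ hρ
  have hint : Integrable (fun p => (⟪p.1, p.2⟫ : ℝ)) γ := by
    refine integrable_inner_of_bounded (R := max R ‖c‖) h1 ?_
    refine ae_of_ae_map (p := fun y => ‖y‖ ≤ max R ‖c‖) measurable_snd.aemeasurable ?_
    change ∀ᵐ y ∂γ.snd, _
    rw [hγ.2.2, ae_map_iff hT.aemeasurable (measurableSet_le measurable_norm measurable_const)]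
    exact ae_of_all _ (norm_tailCollapse_le hR)
  have hmass : γ S = μ A := by
    rw [hSdef, ← Measure.snd_apply (measurableSet_singleton c), hγ.2.2,
      Measure.map_apply hT (measurableSet_singleton c)]
  rw [pairInt_eq_integral hint]
  refine le_trans (le_of_eq ?_) (coe_le_maxCorr_of_add_prod (ρ := ρ) (μ := μ)
    (lam := γ.restrict Sᶜ) (α := (γ.restrict S).fst) (β := μ.restrict A) ?_ ?_ ?_
    hint.integrableOn (integrable_fst_marginal h1.integrableOn) hμ.integrable.integrableOn)
  · rw [integral_fst_marginal, ← setIntegral_tailCollapse hB hR hμ hA hBA,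
      setIntegral_congr_fun (g := fun _ => c) hA fun y hy => hy, setIntegral_const,
      ← integral_add_compl hS hint, add_comm,
      setIntegral_congr_fun (g := fun p => (⟪c, p.1⟫ : ℝ)) hS fun p hp => by
        rw [real_inner_comm, ← show p.2 = c from hp],
      integral_inner h1.integrableOn, measureReal_def, Measure.fst_univ,
      Measure.restrict_apply_univ, hmass, real_inner_smul_right, measureReal_def,
      real_inner_comm]
    congr 2
    by_cases h0 : μ A = 0
    · rw [Measure.restrict_eq_zero.2 (hmass.trans h0)]; simp
    · rw [inv_mul_cancel_left₀ (ENNReal.toReal_ne_zero.2 ⟨h0, measure_ne_top _ _⟩)]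
  · rw [fst_restrict_compl_add hS, hγ.2.1]
  · rw [hSdef, ← Set.preimage_compl, snd_restrict_preimage (measurableSet_singleton c).compl,
      hγ.2.2, Measure.restrict_map hT (measurableSet_singleton c).compl, Set.preimage_compl,
      map_tailCollapse_restrict hA.compl (Set.compl_subset_comm.1 hBA),
      Measure.restrict_compl_add_restrict hA]
  · rw [Measure.fst_univ, Measure.restrict_apply_univ, Measure.restrict_apply_univ, hmass]

/-- Lower bound obtained by keeping most of the coupling `γ` on `B` and coupling the tail together
with a fraction `η` of the remaining mass independently. -/
lemma coe_le_maxCorr_map_tailCollapse {d : ℕ} {ρ μ : Measure (Ed d)} [IsProbabilityMeasure ρ]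
    [IsProbabilityMeasure μ] (hρ : FirstMoment ρ) (hμ : FirstMoment μ) {B : Set (Ed d)}
    (hB : MeasurableSet B) {R : ℝ} (hR : ∀ y ∈ B, ‖y‖ ≤ R) {γ : Measure (Ed d × Ed d)}
    (hγ : γ ∈ Couplings ρ μ) {η : ℝ} (hη0 : 0 < η) (hη1 : η ≤ 1)
    (h1 : ‖∫ p in Prod.snd ⁻¹' Bᶜ, p.1 ∂γ‖ ≤ η) (h2 : ‖∫ y in Bᶜ, y ∂μ‖ ≤ η) :
    (((1 - η) * ∫ p in Prod.snd ⁻¹' B, (⟪p.1, p.2⟫ : ℝ) ∂γ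
        - η * ((1 + ∫ x, ‖x‖ ∂ρ) * (1 + ∫ y, ‖y‖ ∂μ)) : ℝ) : EReal)
      ≤ maxCorr ρ (μ.map (tailCollapse μ B)) := by
  have := hγ.1
  have hT := measurable_tailCollapse (μ := μ) hB
  set E : Set (Ed d × Ed d) := Prod.snd ⁻¹' B with hEdef
  have hE : MeasurableSet E := measurable_snd hB
  rw [Set.preimage_compl, ← hEdef] at h1
  lift η to NNReal using hη0.le
  have hsum : 1 - η + η = 1 := tsub_add_cancel_of_le (mod_cast hη1)
  have hx := integrable_fst_of_mem_couplings hγ hρ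
  have hint : Integrable (fun p => (⟪p.1, p.2⟫ : ℝ)) (γ.restrict E) :=
    integrable_inner_of_bounded hx.integrableOn
      ((ae_restrict_iff' hE).2 (ae_of_all _ fun p hp => hR _ hp))
  set α := (γ.restrict Eᶜ).fst + η • (γ.restrict E).fst with hα
  set β := (μ.restrict Bᶜ).map (tailCollapse μ B) + η • μ.restrict B with hβ
  have hTint : Integrable (fun y => y) ((μ.restrict Bᶜ).map (tailCollapse μ B)) :=
    (integrable_map_measure (g := fun x : Ed d => x) aestronglyMeasurable_id
      hT.aemeasurable).2 (integrable_tailCollapse hB hR).integrableOn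
  have hαi1 := integrable_fst_marginal (hx.integrableOn (s := Eᶜ))
  have hαi2 := integrable_fst_marginal (hx.integrableOn (s := E))
  have hβi2 := hμ.integrable.integrableOn (s := B)
  have hαint : Integrable (fun x => x) α := hαi1.add_measure hαi2.smul_measure_nnreal
  have hβint : Integrable (fun x => x) β := hTint.add_measure hβi2.smul_measure_nnreal
  have hαval : ∫ x, x ∂α = ∫ p in Eᶜ, p.1 ∂γ + η • ∫ p in E, p.1 ∂γ := by
    rw [hα, integral_add_measure hαi1 hαi2.smul_measure_nnreal, integral_smul_nnreal_measure,
      integral_fst_marginal, integral_fst_marginal]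
  have hβval : ∫ y, y ∂β = ∫ y in Bᶜ, y ∂μ + η • ∫ y in B, y ∂μ := by
    rw [hβ, integral_add_measure hTint hβi2.smul_measure_nnreal, integral_smul_nnreal_measure,
      integral_map (f := fun y : Ed d => y) hT.aemeasurable aestronglyMeasurable_id,
      setIntegral_compl_tailCollapse hB]
  have hρn : ∫ x, ‖x‖ ∂ρ = ∫ p : Ed d × Ed d, ‖p.1‖ ∂γ := by
    rw [← hγ.2.1, Measure.fst, integral_map measurable_fst.aemeasurable (by fun_prop)]
  have hαle : ‖∫ x, x ∂α‖ ≤ η * (1 + ∫ x, ‖x‖ ∂ρ) := by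
    rw [hαval, hρn, mul_add, mul_one]
    refine (norm_add_le _ _).trans (add_le_add h1 ?_)
    rw [NNReal.smul_def, norm_smul, Real.norm_of_nonneg η.coe_nonneg]
    gcongr
    exact (norm_integral_le_integral_norm _).trans
      (setIntegral_le_integral hx.norm (ae_of_all _ fun _ => norm_nonneg _))
  have hβle : ‖∫ y, y ∂β‖ ≤ η * (1 + ∫ y, ‖y‖ ∂μ) := by
    rw [hβval, mul_add, mul_one]
    refine (norm_add_le _ _).trans (add_le_add h2 ?_)
    rw [NNReal.smul_def, norm_smul, Real.norm_of_nonneg η.coe_nonneg]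
    gcongr
    exact (norm_integral_le_integral_norm _).trans
      (setIntegral_le_integral hμ (ae_of_all _ fun _ => norm_nonneg _))
  have hmE : γ E = μ B := by rw [hEdef, ← Measure.snd_apply hB, hγ.2.2]
  have hmEc : γ Eᶜ = μ Bᶜ := by
    rw [hEdef, ← Set.preimage_compl, ← Measure.snd_apply hB.compl, hγ.2.2]
  have hmass : (η : ℝ) ≤ α.real Set.univ := by
    have e : α.real Set.univ = γ.real Eᶜ + η * γ.real E := by
      rw [hα, measureReal_add_apply, measureReal_nnreal_smul_apply]
      simp_rw [measureReal_def, Measure.fst_univ, Measure.restrict_apply_univ]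
    rw [e, probReal_compl_eq_one_sub hE]
    nlinarith [measureReal_le_one (μ := γ) (s := E)]
  refine le_trans (EReal.coe_le_coe_iff.2 ?_) (coe_le_maxCorr_of_add_prod (ρ := ρ)
    (lam := (1 - η) • γ.restrict E) (α := α) (β := β) ?_ ?_ ?_
    hint.smul_measure_nnreal hαint hβint)
  · rw [integral_smul_nnreal_measure, NNReal.smul_def, NNReal.coe_sub (mod_cast hη1), smul_eq_mul,
      NNReal.coe_one, sub_eq_add_neg]
    gcongr
    rw [neg_le]
    have hpos : 0 < α.real Set.univ := hη0.trans_le hmass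
    have hin := (neg_le_abs _).trans
      ((abs_real_inner_le_norm (∫ x, x ∂α) (∫ y, y ∂β)).trans
        (mul_le_mul hαle hβle (norm_nonneg _) (by positivity)))
    rw [← mul_neg, inv_mul_le_iff₀ hpos]
    refine hin.trans ?_
    have hnn : 0 ≤ (η : ℝ) * ((1 + ∫ x, ‖x‖ ∂ρ) * (1 + ∫ y, ‖y‖ ∂μ)) := by positivity
    nlinarith [mul_le_mul_of_nonneg_right hmass hnn]
  · rw [hα, Measure.fst, Measure.map_smul, ← Measure.fst, add_comm, add_assoc, ← add_smul,
      add_comm η, hsum, one_smul, fst_restrict_compl_add hE, hγ.2.1]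
  · have e : μ.map (tailCollapse μ B)
        = (μ.restrict Bᶜ).map (tailCollapse μ B) + μ.restrict B := by
      conv_rhs => rw [← map_tailCollapse_restrict (μ := μ) hB subset_rfl]
      rw [← Measure.map_add _ _ hT, Measure.restrict_compl_add_restrict hB]
    rw [e, hβ, Measure.snd, Measure.map_smul, ← Measure.snd, hEdef, snd_restrict_preimage hB,
      hγ.2.2, add_comm, add_assoc, ← add_smul, add_comm η, hsum, one_smul]
  · simp [hα, hβ, Measure.fst_univ, Measure.map_apply hT, hmE, hmEc]

lemma tendsto_lintegral_restrict_iUnion {X : Type*} [MeasurableSpace X] {γ : Measure X}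
    {f : X → ℝ≥0∞} {E : ℕ → Set X} (hE : ∀ n, MeasurableSet (E n))
    (hmono : Monotone E) (hU : ⋃ n, E n = Set.univ) :
    Tendsto (fun n => ∫⁻ p in E n, f p ∂γ) atTop (𝓝 (∫⁻ p, f p ∂γ)) := by
  have h := tendsto_measure_iUnion_atTop (μ := γ.withDensity f) hmono
  rw [hU, withDensity_apply _ MeasurableSet.univ, Measure.restrict_univ] at h
  exact h.congr fun n => withDensity_apply _ (hE n)

lemma tendsto_setIntegral_compl_zero {X : Type*} [MeasurableSpace X] {F : Type*}
    [NormedAddCommGroup F] [NormedSpace ℝ F] {γ : Measure X} {f : X → F} (hf : Integrable f γ)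
    {E : ℕ → Set X} (hE : ∀ n, MeasurableSet (E n))
    (hmono : Monotone E) (hU : ⋃ n, E n = Set.univ) :
    Tendsto (fun n => ∫ p in (E n)ᶜ, f p ∂γ) atTop (𝓝 0) := by
  have h := tendsto_setIntegral_of_antitone (s := fun n => (E n)ᶜ) (fun n => (hE n).compl)
    (fun m n hmn => Set.compl_subset_compl.2 (hmono hmn)) ⟨0, hf.integrableOn⟩
  rwa [← Set.compl_iUnion, hU, Set.compl_univ, setIntegral_empty] at h

/-- If the pairing of `γ` exceeds `b`, so do eventually the integrals over an exhaustion. -/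
lemma eventually_lt_setIntegral_of_lt_pairInt {d : ℕ} {γ : Measure (Ed d × Ed d)}
    {E : ℕ → Set (Ed d × Ed d)} (hE : ∀ n, MeasurableSet (E n)) (hmono : Monotone E)
    (hU : ⋃ n, E n = Set.univ)
    (hint : ∀ n, Integrable (fun p => (⟪p.1, p.2⟫ : ℝ)) (γ.restrict (E n)))
    {b : ℝ} (hb : (b : EReal) < pairInt γ) :
    ∀ᶠ n in atTop, b < ∫ p in E n, (⟪p.1, p.2⟫ : ℝ) ∂γ := by
  have hN : (∫⁻ p, ENNReal.ofReal (-(⟪p.1, p.2⟫ : ℝ)) ∂γ) ≠ ⊤ := by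
    intro h
    rw [pairInt, h, EReal.coe_ennreal_top, EReal.sub_top] at hb
    exact not_lt_bot hb
  have hN' : ((∫⁻ p, ENNReal.ofReal (-(⟪p.1, p.2⟫ : ℝ)) ∂γ : ℝ≥0∞) : EReal) ≠ ⊤ := by
    simpa using hN
  have hlim := (continuous_coe_ennreal_ereal.tendsto _).comp
    (tendsto_lintegral_restrict_iUnion (γ := γ)
      (f := fun p => ENNReal.ofReal (⟪p.1, p.2⟫ : ℝ)) hE hmono hU)
  filter_upwards [hlim.eventually_const_lt (EReal.add_lt_of_lt_sub hb)] with n hn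
  rw [← EReal.coe_lt_coe_iff, ← pairInt_eq_integral (hint n)]
  refine lt_of_lt_of_le ?_ (EReal.sub_le_sub le_rfl
    (EReal.coe_ennreal_le_coe_ennreal_iff.2 (setLIntegral_le_lintegral _ _)))
  exact (EReal.lt_sub_iff_add_lt (.inl (EReal.coe_ennreal_ne_bot _)) (.inl hN')).2 hn

/-- approximation of a centered `μ ∈ P_1` by compactly supported centered
probability measures, with convergence of the maximal correlation against every `ρ ∈ P_1`. -/
theorem maxCorr_approx_target {d : ℕ} (hd : 1 ≤ d)
    (μ : Measure (Ed d)) [IsProbabilityMeasure μ] (hμ1 : FirstMoment μ) (hμc : Centered μ) :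
    ∃ μs : ℕ → Measure (Ed d),
      (∀ n, IsProbabilityMeasure (μs n)) ∧
      (∀ n, ∃ K : Set (Ed d), IsCompact K ∧ μs n Kᶜ = 0) ∧
      (∀ n, Centered (μs n)) ∧
      WeakConv μs μ ∧
      (∀ ρ : Measure (Ed d), IsProbabilityMeasure ρ → FirstMoment ρ →
        Tendsto (fun n => maxCorr ρ (μs n)) atTop (𝓝 (maxCorr ρ μ))) := by
  let B : ℕ → Set (Ed d) := fun n => Metric.closedBall 0 n
  have hB : ∀ n, MeasurableSet (B n) := fun n => measurableSet_closedBall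
  have hR : ∀ n, ∀ y ∈ B n, ‖y‖ ≤ n := fun n y hy => mem_closedBall_zero_iff.1 hy
  have hmono : Monotone B := fun m n h => Metric.closedBall_subset_closedBall (by exact_mod_cast h)
  have hU : ⋃ n, B n = Set.univ := Metric.iUnion_closedBall_nat 0
  have hT : ∀ n, Measurable (tailCollapse μ (B n)) := fun n => measurable_tailCollapse (hB n)
  refine ⟨fun n => μ.map (tailCollapse μ (B n)),
    fun n => Measure.isProbabilityMeasure_map (hT n).aemeasurable, fun n => ?_, fun n => ?_,
    fun f => ?_, fun ρ hρp hρ => ?_⟩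
  · refine ⟨Metric.closedBall 0 (max n ‖⨍ y in (B n)ᶜ, y ∂μ‖), isCompact_closedBall _ _, ?_⟩
    rw [Measure.map_apply (hT n) measurableSet_closedBall.compl]
    convert measure_empty (μ := μ)
    rw [Set.eq_empty_iff_forall_notMem]
    exact fun y hy => hy (mem_closedBall_zero_iff.2 (norm_tailCollapse_le (hR n) y))
  · rw [Centered, integral_map (f := fun y : Ed d => y) (hT n).aemeasurable
      aestronglyMeasurable_id, ← setIntegral_univ,
      setIntegral_tailCollapse (hB n) (hR n) hμ1 MeasurableSet.univ (Set.subset_univ _),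
      setIntegral_univ, hμc]
  · simp_rw [fun n => integral_map (μ := μ) (hT n).aemeasurable
      f.continuous.aestronglyMeasurable]
    refine tendsto_integral_of_dominated_convergence (fun _ => ‖f‖)
      (fun n => (f.continuous.measurable.comp (hT n)).aestronglyMeasurable)
      (integrable_const _) (fun n => ae_of_all _ fun y => f.norm_coe_le_norm _)
      (ae_of_all _ fun y => tendsto_const_nhds.congr' ?_)
    obtain ⟨N, hN⟩ := Set.mem_iUnion.1 (hU.symm ▸ Set.mem_univ y)
    filter_upwards [eventually_ge_atTop N] with n hn
    rw [tailCollapse_of_mem (hmono hn hN)]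
  · refine tendsto_order.2 ⟨fun a ha => ?_, fun a ha => Eventually.of_forall fun n =>
      (maxCorr_map_tailCollapse_le hρ hμ1 (hB n) (hR n)).trans_lt ha⟩
    obtain ⟨γ, hγ, hγa⟩ : ∃ γ, ∃ _ : γ ∈ Couplings ρ μ, a < pairInt γ := by
      simpa only [maxCorr, lt_iSup_iff] using ha
    obtain ⟨b, hab, hb⟩ := EReal.lt_iff_exists_real_btwn.1 hγa
    obtain ⟨b', hbb', hb'⟩ := EReal.lt_iff_exists_real_btwn.1 hb
    have hx := integrable_fst_of_mem_couplings hγ hρ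
    let E : ℕ → Set (Ed d × Ed d) := fun n => Prod.snd ⁻¹' B n
    have hE : ∀ n, MeasurableSet (E n) := fun n => measurable_snd (hB n)
    have hEmono : Monotone E := fun m n h => Set.preimage_mono (hmono h)
    have hEU : ⋃ n, E n = Set.univ := by rw [← Set.preimage_iUnion, hU, Set.preimage_univ]
    have hI := eventually_lt_setIntegral_of_lt_pairInt hE hEmono hEU
      (fun n => integrable_inner_of_bounded (R := n) hx.integrableOn
        ((ae_restrict_iff' (hE n)).2 (ae_of_all _ fun p hp => hR n _ hp))) hb'
    let η : ℕ → ℝ := fun n =>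
      ‖∫ p in (E n)ᶜ, p.1 ∂γ‖ + ‖∫ y in (B n)ᶜ, y ∂μ‖ + 1 / ((n : ℝ) + 1)
    have hη : Tendsto η atTop (𝓝 0) := by
      have := ((tendsto_setIntegral_compl_zero hx hE hEmono hEU).norm.add
        (tendsto_setIntegral_compl_zero hμ1.integrable hB hmono hU).norm).add
        (tendsto_one_div_add_atTop_nhds_zero_nat (𝕜 := ℝ))
      rwa [norm_zero, add_zero, add_zero] at this
    have hlim : Tendsto (fun n => (1 - η n) * b'
        - η n * ((1 + ∫ x, ‖x‖ ∂ρ) * (1 + ∫ y, ‖y‖ ∂μ))) atTop (𝓝 b') := by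
      have := ((tendsto_const_nhds (x := (1 : ℝ))).sub hη).mul_const b' |>.sub
        (hη.mul_const ((1 + ∫ x, ‖x‖ ∂ρ) * (1 + ∫ y, ‖y‖ ∂μ)))
      simpa using this
    filter_upwards [hI, hη.eventually_le_const zero_lt_one,
      hlim.eventually_const_lt (EReal.coe_lt_coe_iff.1 hbb')] with n hIn hηn hn
    have hpos : 0 < 1 / ((n : ℝ) + 1) := by positivity
    have hp1 := norm_nonneg (∫ p in (E n)ᶜ, p.1 ∂γ)
    have hp2 := norm_nonneg (∫ y in (B n)ᶜ, y ∂μ)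
    refine (hab.trans (EReal.coe_lt_coe_iff.2 ?_)).trans_le
      (coe_le_maxCorr_map_tailCollapse hρ hμ1 (hB n) (hR n) hγ (η := η n)
        (by positivity) hηn ?_ ?_)
    · refine hn.trans_le (sub_le_sub_right (mul_le_mul_of_nonneg_left hIn.le ?_) _)
      linarith
    · rw [Set.preimage_compl]
      change _ ≤ _ + _ + _
      linarith
    · change _ ≤ _ + _ + _
      linarith
end
end

section
/- Let d ≥ 1 and let ρ ∈ P_1(ℝ^d). Then there exists a sequence ρ_n of compactly supported Borel probability measures on ℝ^d converging weakly to ρ such that E(ρ_n) → E(ρ) (convergence in (−∞,+∞]) and such that for every centered μ ∈ P_1(ℝ^d) one has T(ρ_n,μ) → T(ρ,μ) (convergence in [0,+∞]). -/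
open MeasureTheory Real Filter Topology
open scoped ENNReal RealInnerProductSpace

noncomputable section

open scoped ProbabilityTheory

lemma tendsto_coe_sub_coe {ι : Type*} {l : Filter ι} {a b : ι → ℝ≥0∞} {x y : ℝ≥0∞}
    (ha : Tendsto a l (𝓝 x)) (hb : Tendsto b l (𝓝 y)) (hy : y ≠ ⊤) :
    Tendsto (fun i => (a i : EReal) - (b i : EReal)) l (𝓝 ((x : EReal) - (y : EReal))) := by
  have hc := (EReal.continuousAt_add (p := ((x : EReal), -(y : EReal)))
    (Or.inr (by simpa using hy)) (Or.inl (by simp))).tendsto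
  have h1 := (continuous_coe_ennreal_ereal.tendsto x).comp ha
  have h2 := (continuous_neg.tendsto _).comp ((continuous_coe_ennreal_ereal.tendsto y).comp hb)
  simp only [sub_eq_add_neg]
  exact hc.comp (h1.prodMk_nhds h2)

section Truncation

variable {α : Type*} [MeasurableSpace α] {ρ : Measure α} {B : ℕ → Set α}

lemma tendsto_measure_of_eventually_mem [IsProbabilityMeasure ρ]
    (hm : ∀ n, MeasurableSet (B n)) (hB : ∀ x, ∀ᶠ n in atTop, x ∈ B n) :
    Tendsto (fun n => ρ (B n)) atTop (𝓝 1) := by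
  have hc : AECover ρ atTop B := ⟨ae_of_all _ hB, hm⟩
  simpa using hc.lintegral_tendsto_of_countably_generated (f := fun _ => 1) aemeasurable_const

lemma tendsto_measure_compl_of_eventually_mem [IsProbabilityMeasure ρ]
    (hm : ∀ n, MeasurableSet (B n)) (hB : ∀ x, ∀ᶠ n in atTop, x ∈ B n) :
    Tendsto (fun n => ρ (B n)ᶜ) atTop (𝓝 0) := by
  have h := ENNReal.Tendsto.sub (tendsto_const_nhds (x := (1 : ℝ≥0∞)))
    (tendsto_measure_of_eventually_mem (ρ := ρ) hm hB) (Or.inl ENNReal.one_ne_top)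
  simpa [prob_compl_eq_one_sub (hm _)] using h

lemma measure_smul_cond [IsFiniteMeasure ρ] {s : Set α} (hs : ρ s ≠ 0) :
    ρ s • ρ[|s] = ρ.restrict s := by
  rw [ProbabilityTheory.cond, smul_smul, ENNReal.mul_inv_cancel hs (measure_ne_top _ _), one_smul]

end Truncation

lemma weakConv_cond {d : ℕ} {ρ : Measure (Ed d)} [IsProbabilityMeasure ρ] {B : ℕ → Set (Ed d)}
    (hm : ∀ n, MeasurableSet (B n)) (hB : ∀ x, ∀ᶠ n in atTop, x ∈ B n) :
    WeakConv (fun n => ρ[|B n]) ρ := by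
  intro f
  have hc : AECover ρ atTop B := ⟨ae_of_all _ hB, hm⟩
  have h1 := hc.integral_tendsto_of_countably_generated (f.integrable ρ)
  have h2 := (ENNReal.tendsto_toReal (by simp)).comp
    (tendsto_inv_iff.2 (tendsto_measure_of_eventually_mem (ρ := ρ) hm hB))
  simpa [ProbabilityTheory.cond] using h2.mul h1

section Transport

variable {d : ℕ} {ρ μ : Measure (Ed d)}

lemma ofReal_inner_le (x y : Ed d) : ENNReal.ofReal ⟪x, y⟫ ≤ ‖x‖ₑ * ‖y‖ₑ := by
  rw [← ofReal_norm, ← ofReal_norm, ← ENNReal.ofReal_mul (norm_nonneg _)]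
  exact ENNReal.ofReal_le_ofReal (real_inner_le_norm x y)

lemma ofReal_neg_inner_le (x y : Ed d) : ENNReal.ofReal (-⟪x, y⟫) ≤ ‖x‖ₑ * ‖y‖ₑ := by
  simpa using ofReal_inner_le (-x) y

lemma FirstMoment.integrable_id (h : FirstMoment ρ) : Integrable (fun x => x) ρ :=
  (integrable_norm_iff aestronglyMeasurable_id).1 h

lemma FirstMoment.lintegral_enorm_ne_top (h : FirstMoment ρ) : ∫⁻ x, ‖x‖ₑ ∂ρ ≠ ⊤ :=
  h.integrable_id.2.ne

lemma lintegral_prod_enorm_mul_enorm [SFinite μ] :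
    ∫⁻ p, ‖p.1‖ₑ * ‖p.2‖ₑ ∂(ρ.prod μ) = (∫⁻ x, ‖x‖ₑ ∂ρ) * ∫⁻ y, ‖y‖ₑ ∂μ :=
  lintegral_prod_mul measurable_enorm.aemeasurable measurable_enorm.aemeasurable

/-- The positive and negative parts of the pairing have the same finite integral against a product
measure whose second factor is centered. -/
lemma lintegral_inner_prod_centered [IsFiniteMeasure ρ] [IsFiniteMeasure μ]
    (hρ : FirstMoment ρ) (hμ : FirstMoment μ) (hc : Centered μ) :
    ∫⁻ p, ENNReal.ofReal ⟪p.1, p.2⟫ ∂(ρ.prod μ) ≠ ⊤ ∧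
      ∫⁻ p, ENNReal.ofReal (-⟪p.1, p.2⟫) ∂(ρ.prod μ)
        = ∫⁻ p, ENNReal.ofReal ⟪p.1, p.2⟫ ∂(ρ.prod μ) := by
  have hfin : ∫⁻ p, ‖p.1‖ₑ * ‖p.2‖ₑ ∂(ρ.prod μ) ≠ ⊤ := by
    rw [lintegral_prod_enorm_mul_enorm]
    exact ENNReal.mul_ne_top hρ.lintegral_enorm_ne_top hμ.lintegral_enorm_ne_top
  have hp := ((lintegral_mono (μ := ρ.prod μ) fun p => ofReal_inner_le p.1 p.2).trans_lt
    hfin.lt_top).ne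
  have hn := ((lintegral_mono (μ := ρ.prod μ) fun p => ofReal_neg_inner_le p.1 p.2).trans_lt
    hfin.lt_top).ne
  have hint : Integrable (fun p : Ed d × Ed d => (⟪p.1, p.2⟫ : ℝ)) (ρ.prod μ) := by
    refine ⟨by fun_prop, (lintegral_mono fun p => ?_).trans_lt hfin.lt_top⟩
    rw [← ofReal_norm, ← ofReal_norm, ← ofReal_norm, ← ENNReal.ofReal_mul (norm_nonneg _)]
    exact ENNReal.ofReal_le_ofReal (norm_inner_le_norm p.1 p.2)
  have h0 : ∫ p, (⟪p.1, p.2⟫ : ℝ) ∂(ρ.prod μ) = 0 := by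
    rw [integral_prod _ hint]
    have hx : ∀ x : Ed d, ∫ y, (⟪x, y⟫ : ℝ) ∂μ = 0 := fun x => by
      rw [integral_inner hμ.integrable_id, hc, inner_zero_right]
    simp [hx]
  rw [integral_eq_lintegral_pos_part_sub_lintegral_neg_part hint] at h0
  exact ⟨hp, ((ENNReal.toReal_eq_toReal_iff' hp hn).1 (sub_eq_zero.1 h0)).symm⟩

lemma maxCorr_nonneg [IsProbabilityMeasure ρ] [IsProbabilityMeasure μ]
    (hρ : FirstMoment ρ) (hμ : FirstMoment μ) (hc : Centered μ) : 0 ≤ maxCorr ρ μ := by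
  obtain ⟨hp, heq⟩ := lintegral_inner_prod_centered hρ hμ hc
  refine le_iSup₂_of_le (ρ.prod μ)
    ⟨inferInstance, Measure.fst_prod, Measure.snd_prod⟩ ?_
  rw [pairInt, heq, EReal.sub_self (by simpa using hp) (by simp)]

/-- A coupling of the conditioned measure `ρ[|s]` extends to a coupling of `ρ` by gluing a product
coupling on the complement of `s`, which does not contribute to the pairing. -/
lemma measure_mul_pairInt_le_maxCorr [IsProbabilityMeasure ρ] [IsProbabilityMeasure μ]
    (hρ : FirstMoment ρ) (hμ : FirstMoment μ) (hc : Centered μ) {s : Set (Ed d)}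
    (hs : MeasurableSet s) (hs0 : ρ s ≠ 0) {γ : Measure (Ed d × Ed d)}
    (hγ : γ ∈ Couplings (ρ[|s]) μ) : (ρ s : EReal) * pairInt γ ≤ maxCorr ρ μ := by
  obtain ⟨hγp, hfst, hsnd⟩ := hγ
  obtain ⟨hp, heq⟩ := lintegral_inner_prod_centered (ρ := ρ.restrict sᶜ)
    (Integrable.restrict hρ) hμ hc
  have hmem : ρ s • γ + (ρ.restrict sᶜ).prod μ ∈ Couplings ρ μ := by
    have h1 : (ρ s • γ + (ρ.restrict sᶜ).prod μ).fst = ρ := by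
      rw [Measure.fst_add, Measure.fst_prod, Measure.fst, Measure.map_smul, ← Measure.fst, hfst,
        measure_smul_cond hs0, Measure.restrict_add_restrict_compl hs]
    refine ⟨⟨?_⟩, h1, ?_⟩
    · rw [← Measure.fst_univ, h1, measure_univ]
    · rw [Measure.snd_add, Measure.snd, Measure.map_smul, ← Measure.snd, hsnd, Measure.snd,
        Measure.map_snd_prod, Measure.restrict_apply_univ, ← add_smul,
        prob_add_prob_compl hs, one_smul]
  refine le_trans (le_of_eq ?_) (le_iSup₂_of_le _ hmem le_rfl)
  have hcoe : ((ρ s).toReal : EReal) = (ρ s : EReal) :=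
    EReal.coe_ennreal_toReal (measure_ne_top _ _)
  have hq := EReal.coe_ennreal_toReal hp
  rw [pairInt, pairInt, lintegral_add_measure, lintegral_add_measure, lintegral_smul_measure,
    lintegral_smul_measure, heq, smul_eq_mul, smul_eq_mul]
  have hr : 0 < (ρ s).toReal := ENNReal.toReal_pos hs0 (measure_ne_top _ _)
  generalize ∫⁻ p, ENNReal.ofReal ⟪p.1, p.2⟫ ∂γ = a
  generalize ∫⁻ p, ENNReal.ofReal (-⟪p.1, p.2⟫) ∂γ = b
  push_cast
  rw [← hcoe, ← hq]
  generalize (ρ s).toReal = r at hr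
  generalize ENNReal.toReal _ = q
  have h1 : ((r : EReal) * ⊤) = ⊤ := EReal.coe_mul_top_of_pos hr
  have h2 : ((r : EReal) * ⊥) = ⊥ := EReal.coe_mul_bot_of_pos hr
  induction a using ENNReal.recTopCoe <;> induction b using ENNReal.recTopCoe
  · simp [h1, h2]
  · simp only [EReal.coe_ennreal_top, EReal.coe_nnreal_eq_coe_real]
    rw [h1, EReal.top_add_coe, ← EReal.coe_mul, ← EReal.coe_add, EReal.top_sub_coe,
      EReal.top_sub_coe, h1]
  · simp only [EReal.coe_ennreal_top, EReal.coe_nnreal_eq_coe_real]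
    norm_cast
    simp [h1, h2]
  · simp only [EReal.coe_nnreal_eq_coe_real]
    norm_cast
    ring

lemma restrict_add_prod_mem_couplings [IsProbabilityMeasure ρ] {s : Set (Ed d)}
    (hs : MeasurableSet s) (hs0 : ρ s ≠ 0) {γ : Measure (Ed d × Ed d)}
    (hγ : γ ∈ Couplings ρ μ) :
    γ.restrict (Prod.fst ⁻¹' s) + (ρ[|s]).prod (γ.restrict (Prod.fst ⁻¹' sᶜ)).snd
      ∈ Couplings (ρ[|s]) μ := by
  obtain ⟨hγp, hfst, hsnd⟩ := hγ
  have : IsProbabilityMeasure (ρ[|s]) := ProbabilityTheory.cond_isProbabilityMeasure hs0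
  have hm : (γ.restrict (Prod.fst ⁻¹' sᶜ)) Set.univ = ρ sᶜ := by
    rw [Measure.restrict_apply_univ, ← Measure.fst_apply hs.compl, hfst]
  have h1 : (γ.restrict (Prod.fst ⁻¹' s) +
      (ρ[|s]).prod (γ.restrict (Prod.fst ⁻¹' sᶜ)).snd).fst = ρ[|s] := by
    have h2 : (γ.restrict (Prod.fst ⁻¹' s)).fst = ρ s • ρ[|s] := by
      rw [Measure.fst, ← Measure.restrict_map measurable_fst hs, ← Measure.fst, hfst,
        measure_smul_cond hs0]
    rw [Measure.fst_add, h2, Measure.fst, Measure.map_fst_prod, Measure.snd_univ, hm,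
      ← add_smul, prob_add_prob_compl hs, one_smul]
  refine ⟨⟨?_⟩, h1, ?_⟩
  · rw [← Measure.fst_univ, h1, measure_univ]
  · rw [Measure.snd_add, Measure.snd_prod, ← Measure.snd_add, Set.preimage_compl,
      Measure.restrict_add_restrict_compl (measurable_fst hs), hsnd]

/-- Convergence of one part of the pairing along the couplings of
`restrict_add_prod_mem_couplings`. -/
lemma tendsto_lintegral_restrict_add_prod [IsProbabilityMeasure ρ]
    (hρ : FirstMoment ρ) (hμ : FirstMoment μ) {B : ℕ → Set (Ed d)}
    (hm : ∀ n, MeasurableSet (B n)) (hB : ∀ x, ∀ᶠ n in atTop, x ∈ B n)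
    {γ : Measure (Ed d × Ed d)} (hγ : γ ∈ Couplings ρ μ) {F : Ed d × Ed d → ℝ≥0∞}
    (hF : Measurable F) (hle : ∀ p, F p ≤ ‖p.1‖ₑ * ‖p.2‖ₑ) :
    Tendsto (fun n => ∫⁻ p, F p ∂(γ.restrict (Prod.fst ⁻¹' B n) +
        (ρ[|B n]).prod (γ.restrict (Prod.fst ⁻¹' (B n)ᶜ)).snd)) atTop
      (𝓝 (∫⁻ p, F p ∂γ)) := by
  obtain ⟨hγp, hfst, hsnd⟩ := hγ
  have hm' : ∀ n, MeasurableSet ((Prod.fst : Ed d × Ed d → Ed d) ⁻¹' B n) :=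
    fun n => measurable_fst (hm n)
  have hc : AECover γ atTop (fun n => Prod.fst ⁻¹' B n) := ⟨ae_of_all _ fun p => hB p.1, hm'⟩
  have hmain := hc.lintegral_tendsto_of_countably_generated hF.aemeasurable
  have htail : Tendsto (fun n => ∫⁻ p in (Prod.fst ⁻¹' B n)ᶜ, ‖p.2‖ₑ ∂γ) atTop (𝓝 0) := by
    refine tendsto_setLIntegral_zero ?_
      (tendsto_measure_compl_of_eventually_mem hm' fun p => hB p.1)
    rw [← lintegral_map measurable_enorm measurable_snd, ← Measure.snd, hsnd]
    exact hμ.lintegral_enorm_ne_top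
  have hinv := tendsto_inv_iff.2 (tendsto_measure_of_eventually_mem (ρ := ρ) hm hB)
  have hbd : Tendsto (fun n => (ρ (B n))⁻¹ * (∫⁻ x, ‖x‖ₑ ∂ρ) *
      ∫⁻ p in (Prod.fst ⁻¹' B n)ᶜ, ‖p.2‖ₑ ∂γ) atTop (𝓝 0) := by
    have h1 := ENNReal.Tendsto.mul_const (b := ∫⁻ x, ‖x‖ₑ ∂ρ) hinv
      (Or.inr hρ.lintegral_enorm_ne_top)
    have h2 := ENNReal.Tendsto.mul h1 (Or.inr ENNReal.zero_ne_top) htail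
      (Or.inr (by simpa using hρ.lintegral_enorm_ne_top))
    simpa using h2
  have hprod : Tendsto (fun n => ∫⁻ p, F p ∂((ρ[|B n]).prod
      (γ.restrict (Prod.fst ⁻¹' (B n)ᶜ)).snd)) atTop (𝓝 0) := by
    refine tendsto_of_tendsto_of_tendsto_of_le_of_le tendsto_const_nhds hbd
      (fun _ => zero_le) fun n => (lintegral_mono hle).trans ?_
    rw [lintegral_prod_enorm_mul_enorm, Measure.snd, lintegral_map measurable_enorm measurable_snd,
      ProbabilityTheory.cond, lintegral_smul_measure, smul_eq_mul, Set.preimage_compl]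
    gcongr
    exact Measure.restrict_le_self
  simpa [lintegral_add_measure] using hmain.add hprod

lemma tendsto_maxCorr_cond [IsProbabilityMeasure ρ] [IsProbabilityMeasure μ]
    (hρ : FirstMoment ρ) (hμ : FirstMoment μ) (hc : Centered μ) {B : ℕ → Set (Ed d)}
    (hm : ∀ n, MeasurableSet (B n)) (hB : ∀ x, ∀ᶠ n in atTop, x ∈ B n) (h0 : ∀ n, ρ (B n) ≠ 0) :
    Tendsto (fun n => maxCorr (ρ[|B n]) μ) atTop (𝓝 (maxCorr ρ μ)) := by
  refine tendsto_order.2 ⟨fun b hb => ?_, fun b hb => ?_⟩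
  · obtain ⟨γ, hγ⟩ := lt_iSup_iff.1 hb
    obtain ⟨hmem, hlt⟩ := lt_iSup_iff.1 hγ
    have hneg : ∫⁻ p, ENNReal.ofReal (-⟪p.1, p.2⟫) ∂γ ≠ ⊤ := fun h => by
      simp [pairInt, h] at hlt
    have ht := tendsto_coe_sub_coe
      (tendsto_lintegral_restrict_add_prod hρ hμ hm hB hmem (by fun_prop)
        fun p => ofReal_inner_le p.1 p.2)
      (tendsto_lintegral_restrict_add_prod hρ hμ hm hB hmem (by fun_prop)
        fun p => ofReal_neg_inner_le p.1 p.2) hneg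
    filter_upwards [ht.eventually (lt_mem_nhds hlt)] with n hn
    exact hn.trans_le (le_iSup₂_of_le _
      (restrict_add_prod_mem_couplings (hm n) (h0 n) hmem) le_rfl)
  · have hnn := maxCorr_nonneg hρ hμ hc
    lift maxCorr ρ μ to ℝ using ⟨ne_top_of_lt hb, ne_bot_of_le_ne_bot (by simp) hnn⟩ with t ht
    have hle : ∀ n, maxCorr (ρ[|B n]) μ ≤ ((t / (ρ (B n)).toReal : ℝ) : EReal) := fun n => by
      refine iSup₂_le fun γ hγ => ?_
      have h := measure_mul_pairInt_le_maxCorr hρ hμ hc (hm n) (h0 n) hγ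
      have hr : 0 < (ρ (B n)).toReal := ENNReal.toReal_pos (h0 n) (measure_ne_top _ _)
      rw [← ht, ← EReal.coe_ennreal_toReal (measure_ne_top _ _)] at h
      rw [EReal.coe_div]
      refine (EReal.le_div_iff_mul_le (by exact_mod_cast hr) (by simp)).2 ?_
      rwa [mul_comm]
    have hlim : Tendsto (fun n => ((t / (ρ (B n)).toReal : ℝ) : EReal)) atTop (𝓝 (t : EReal)) := by
      have h1 := (ENNReal.tendsto_toReal ENNReal.one_ne_top).comp
        (tendsto_measure_of_eventually_mem (ρ := ρ) hm hB)
      have h2 := (tendsto_const_nhds (x := t)).div h1 (by simp)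
      rw [ENNReal.toReal_one, div_one] at h2
      exact (continuous_coe_real_ereal.tendsto _).comp h2
    filter_upwards [hlim.eventually (gt_mem_nhds hb)] with n hn
    exact (hle n).trans_lt hn

end Transport

section Entropy

lemma neg_mul_log_le_mul_add_exp_neg {t : ℝ} (ht : 0 ≤ t) (s : ℝ) :
    -(t * log t) ≤ t * s + exp (-s) := by
  rcases ht.eq_or_lt with rfl | ht
  · simpa using (exp_pos (-s)).le
  · have h := log_le_sub_one_of_pos (div_pos (exp_pos (-s)) ht)
    rw [log_div (exp_pos _).ne' ht.ne', log_exp] at h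
    have h1 := mul_le_mul_of_nonneg_left h ht.le
    have h2 : t * (exp (-s) / t - 1) = exp (-s) - t := by field_simp
    linarith

lemma neg_mul_log_le_add_rpow {t : ℝ} (ht : 0 ≤ t) {r : ℝ} (hr : 0 ≤ r) {a : ℝ} (ha : 0 ≤ a) :
    -(t * log t) ≤ r * (t * a) + (1 + a) ^ (-r) := by
  have h := neg_mul_log_le_mul_add_exp_neg ht (r * log (1 + a))
  have h1 : (1 + a) ^ (-r) = exp (-(r * log (1 + a))) := by
    rw [rpow_def_of_pos (by linarith)]
    ring_nf
  have h2 : log (1 + a) ≤ a := by linarith [log_le_sub_one_of_pos (show 0 < 1 + a by linarith)]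
  have h3 : t * (r * log (1 + a)) ≤ r * (t * a) := by
    nlinarith [mul_le_mul_of_nonneg_left h2 (mul_nonneg ht hr)]
  linarith

/-- A finite first moment makes the negative part of the entropy integral finite. -/
lemma lintegral_neg_mul_log_rnDeriv_ne_top {d : ℕ} {ρ : Measure (Ed d)} [IsFiniteMeasure ρ]
    (hρ : FirstMoment ρ) (hac : ρ ≪ volume) :
    ∫⁻ x, ENNReal.ofReal (-((ρ.rnDeriv volume x).toReal *
      log (ρ.rnDeriv volume x).toReal)) ≠ ⊤ := by
  have hr : (0 : ℝ) ≤ d + 1 := by positivity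
  have hJ : Integrable (fun x : Ed d => (1 + ‖x‖) ^ (-((d : ℝ) + 1))) volume :=
    integrable_one_add_norm (by simp)
  have hle : ∀ x : Ed d, ENNReal.ofReal (-((ρ.rnDeriv volume x).toReal *
      log (ρ.rnDeriv volume x).toReal)) ≤
      ENNReal.ofReal (d + 1) * (ρ.rnDeriv volume x * ‖x‖ₑ) +
        ENNReal.ofReal ((1 + ‖x‖) ^ (-((d : ℝ) + 1))) := fun x => by
    refine (ENNReal.ofReal_le_ofReal
      (neg_mul_log_le_add_rpow ENNReal.toReal_nonneg hr (norm_nonneg x))).trans ?_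
    refine ENNReal.ofReal_add_le.trans ?_
    rw [ENNReal.ofReal_mul hr, ENNReal.ofReal_mul ENNReal.toReal_nonneg, ofReal_norm]
    gcongr
    exact ENNReal.ofReal_toReal_le
  refine ((lintegral_mono hle).trans_lt ?_).ne
  rw [lintegral_add_right _ (by fun_prop), lintegral_const_mul _ (by fun_prop),
    lintegral_rnDeriv_mul hac measurable_enorm.aemeasurable]
  exact ENNReal.add_lt_top.2 ⟨ENNReal.mul_lt_top ENNReal.ofReal_lt_top
    hρ.lintegral_enorm_ne_top.lt_top, hJ.lintegral_lt_top⟩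

lemma rnDeriv_cond_toReal {α : Type*} [MeasurableSpace α] {ρ ν : Measure α} [IsFiniteMeasure ρ]
    [SigmaFinite ν] {s : Set α} (hs : MeasurableSet s) (hs0 : ρ s ≠ 0) :
    ∀ᵐ x ∂ν, ((ρ[|s]).rnDeriv ν x).toReal =
      s.indicator (fun x => (ρ s).toReal⁻¹ * (ρ.rnDeriv ν x).toReal) x := by
  filter_upwards [Measure.rnDeriv_smul_left_of_ne_top (ρ.restrict s) ν
    (ENNReal.inv_ne_top.2 hs0), Measure.rnDeriv_restrict ρ ν hs] with x h1 h2
  rw [ProbabilityTheory.cond, h1, Pi.smul_apply, h2]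
  by_cases hx : x ∈ s <;> simp [hx]

lemma ofReal_mul_log_smul_le {k t : ℝ} (hk : 1 ≤ k) (hk2 : k ≤ 2) (ht : 0 ≤ t) :
    ENNReal.ofReal (k * t * log (k * t)) ≤
      2 * ENNReal.ofReal (t * log t) + 2 * ENNReal.ofReal t := by
  rcases ht.eq_or_lt with rfl | ht
  · simp
  · have hlog : log k ≤ 1 := by linarith [log_le_sub_one_of_pos (show 0 < k by linarith)]
    rw [log_mul (by linarith) ht.ne',
      show k * t * (log k + log t) = k * (t * log t) + (k * log k) * t by ring]
    refine ENNReal.ofReal_add_le.trans ?_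
    rw [ENNReal.ofReal_mul (by linarith), ENNReal.ofReal_mul (by
      have := log_nonneg hk
      positivity)]
    have h2 : (2 : ℝ≥0∞) = ENNReal.ofReal 2 := by simp
    have h3 : k * log k ≤ 2 := by nlinarith [log_nonneg hk]
    rw [h2, ← ENNReal.ofReal_mul zero_le_two (q := t)]
    gcongr

lemma ofReal_neg_mul_log_smul_le {k t : ℝ} (hk : 1 ≤ k) (hk2 : k ≤ 2) (ht : 0 ≤ t) :
    ENNReal.ofReal (-(k * t * log (k * t))) ≤ 2 * ENNReal.ofReal (-(t * log t)) := by
  rcases ht.eq_or_lt with rfl | ht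
  · simp
  · have h2 : (2 : ℝ≥0∞) = ENNReal.ofReal 2 := by simp
    calc ENNReal.ofReal (-(k * t * log (k * t)))
        ≤ ENNReal.ofReal (k * -(t * log t)) := by
          refine ENNReal.ofReal_le_ofReal ?_
          rw [log_mul (by linarith) ht.ne']
          have := mul_nonneg (mul_nonneg (show 0 ≤ k by linarith) ht.le) (log_nonneg hk)
          nlinarith
      _ = ENNReal.ofReal k * ENNReal.ofReal (-(t * log t)) := ENNReal.ofReal_mul (by linarith)
      _ ≤ _ := by rw [h2]; gcongr

/-- Convergence of the two parts of the entropy integral under truncation and renormalisation of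
a density. -/
lemma tendsto_lintegral_mul_log_indicator {α : Type*} [MeasurableSpace α] {ν : Measure α}
    {u : α → ℝ} (hu : Measurable u) (hu0 : ∀ x, 0 ≤ u x)
    (hint : ∫⁻ x, ENNReal.ofReal (u x) ∂ν ≠ ⊤)
    (hneg : ∫⁻ x, ENNReal.ofReal (-(u x * log (u x))) ∂ν ≠ ⊤)
    {B : ℕ → Set α} (hm : ∀ n, MeasurableSet (B n)) (hB : ∀ x, ∀ᶠ n in atTop, x ∈ B n)
    {k : ℕ → ℝ} (hk1 : ∀ n, 1 ≤ k n) (hk : Tendsto k atTop (𝓝 1)) :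
    Tendsto (fun n => ∫⁻ x, ENNReal.ofReal ((B n).indicator (fun x => k n * u x) x *
        log ((B n).indicator (fun x => k n * u x) x)) ∂ν) atTop
      (𝓝 (∫⁻ x, ENNReal.ofReal (u x * log (u x)) ∂ν)) ∧
    Tendsto (fun n => ∫⁻ x, ENNReal.ofReal (-((B n).indicator (fun x => k n * u x) x *
        log ((B n).indicator (fun x => k n * u x) x))) ∂ν) atTop
      (𝓝 (∫⁻ x, ENNReal.ofReal (-(u x * log (u x))) ∂ν)) := by
  have hlim : ∀ x, Tendsto (fun n => (B n).indicator (fun x => k n * u x) x *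
      log ((B n).indicator (fun x => k n * u x) x)) atTop (𝓝 (u x * log (u x))) := fun x => by
    refine (continuous_mul_log.tendsto (u x)).comp ?_
    have h : Tendsto (fun n => k n * u x) atTop (𝓝 (u x)) := by simpa using hk.mul_const (u x)
    refine h.congr' ?_
    filter_upwards [hB x] with n hn
    rw [Set.indicator_of_mem hn]
  have hgm : ∀ n, Measurable (fun x => (B n).indicator (fun x => k n * u x) x) := fun n =>
    (hu.const_mul _).indicator (hm n)
  have hk2 : ∀ᶠ n in atTop, k n ≤ 2 := hk.eventually (Iic_mem_nhds one_lt_two)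
  have hpm : ∀ n, Measurable (fun x => ENNReal.ofReal ((B n).indicator (fun x => k n * u x) x *
      log ((B n).indicator (fun x => k n * u x) x))) := fun n =>
    ((hgm n).mul (hgm n).log).ennreal_ofReal
  constructor
  · by_cases hpos : ∫⁻ x, ENNReal.ofReal (u x * log (u x)) ∂ν = ⊤
    · refine tendsto_of_le_liminf_of_limsup_le ?_ (by rw [hpos]; exact le_top)
      refine le_trans (le_of_eq (lintegral_congr fun x => ?_)) (lintegral_liminf_le hpm)
      exact ((ENNReal.tendsto_ofReal (hlim x)).liminf_eq).symm
    · refine tendsto_lintegral_filter_of_dominated_convergence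
        (fun x => 2 * ENNReal.ofReal (u x * log (u x)) + 2 * ENNReal.ofReal (u x))
        (Eventually.of_forall hpm) ?_ ?_ (ae_of_all _ fun x => ENNReal.tendsto_ofReal (hlim x))
      · filter_upwards [hk2] with n hn
        refine ae_of_all _ fun x => ?_
        by_cases hx : x ∈ B n
        · simpa [hx] using ofReal_mul_log_smul_le (hk1 n) hn (hu0 x)
        · simp [hx]
      · rw [lintegral_add_right _ (by fun_prop), lintegral_const_mul _ (by fun_prop),
          lintegral_const_mul _ (by fun_prop)]
        exact ENNReal.add_ne_top.2 ⟨ENNReal.mul_ne_top (by simp) hpos,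
          ENNReal.mul_ne_top (by simp) hint⟩
  · refine tendsto_lintegral_filter_of_dominated_convergence
      (fun x => 2 * ENNReal.ofReal (-(u x * log (u x))))
      (Eventually.of_forall fun n => ((hgm n).mul (hgm n).log).neg.ennreal_ofReal) ?_ ?_
      (ae_of_all _ fun x => ENNReal.tendsto_ofReal (hlim x).neg)
    · filter_upwards [hk2] with n hn
      refine ae_of_all _ fun x => ?_
      by_cases hx : x ∈ B n
      · simpa [hx] using ofReal_neg_mul_log_smul_le (hk1 n) hn (hu0 x)
      · simp [hx]
    · rw [lintegral_const_mul _ (by fun_prop)]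
      exact ENNReal.mul_ne_top (by simp) hneg

lemma tendsto_entropy_cond {d : ℕ} {ρ : Measure (Ed d)} [IsProbabilityMeasure ρ]
    (hρ : FirstMoment ρ) {B : ℕ → Set (Ed d)} (hm : ∀ n, MeasurableSet (B n))
    (hB : ∀ x, ∀ᶠ n in atTop, x ∈ B n) (h0 : ∀ n, ρ (B n) ≠ 0) :
    Tendsto (fun n => entropy (ρ[|B n])) atTop (𝓝 (entropy ρ)) := by
  by_cases hac : ρ ≪ volume
  · have hac' : ∀ n, ρ[|B n] ≪ volume := fun n =>
      ProbabilityTheory.cond_absolutelyContinuous.trans hac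
    have hneg := lintegral_neg_mul_log_rnDeriv_ne_top hρ hac
    have hint : ∫⁻ x, ENNReal.ofReal (ρ.rnDeriv volume x).toReal ≠ ⊤ :=
      ((lintegral_mono fun x => ENNReal.ofReal_toReal_le).trans_lt
        (Measure.lintegral_rnDeriv_lt_top ρ volume)).ne
    have hk1 : ∀ n, 1 ≤ (ρ (B n)).toReal⁻¹ := fun n =>
      (one_le_inv₀ (ENNReal.toReal_pos (h0 n) (measure_ne_top _ _))).2
        (ENNReal.toReal_le_of_le_ofReal zero_le_one (by simpa using prob_le_one))
    have hk : Tendsto (fun n => (ρ (B n)).toReal⁻¹) atTop (𝓝 1) := by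
      have h1 := (ENNReal.tendsto_toReal ENNReal.one_ne_top).comp
        (tendsto_measure_of_eventually_mem (ρ := ρ) hm hB)
      simpa using h1.inv₀ (by simp)
    obtain ⟨hp, hn⟩ := tendsto_lintegral_mul_log_indicator
      (Measure.measurable_rnDeriv ρ volume).ennreal_toReal (fun _ => ENNReal.toReal_nonneg)
      hint hneg hm hB hk1 hk
    rw [entropy, if_pos hac]
    refine (tendsto_coe_sub_coe hp hn hneg).congr fun n => ?_
    rw [entropy, if_pos (hac' n)]
    congr 2 <;> refine lintegral_congr_ae ?_ <;>
      filter_upwards [rnDeriv_cond_toReal (ν := volume) (hm n) (h0 n)] with x hx <;> rw [hx]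
  · rw [entropy, if_neg hac]
    obtain ⟨N, hN, hρN⟩ : ∃ N, volume N = 0 ∧ ρ N ≠ 0 := by
      by_contra! h
      exact hac fun s hs => h s hs
    have hc : AECover (ρ.restrict N) atTop B := ⟨ae_of_all _ hB, hm⟩
    have h1 := hc.lintegral_tendsto_of_countably_generated (f := fun _ => 1) aemeasurable_const
    simp only [lintegral_const, one_mul, Measure.restrict_apply_univ,
      Measure.restrict_apply (hm _)] at h1
    refine tendsto_const_nhds.congr' ?_
    filter_upwards [h1.eventually (lt_mem_nhds (pos_iff_ne_zero.2 hρN))] with n hn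
    rw [entropy, if_neg]
    intro h
    have := h hN
    rw [ProbabilityTheory.cond_apply (hm n)] at this
    simp [hn.ne'] at this

end Entropy

/-- approximation of `ρ ∈ P_1` by compactly supported probability measures,
with convergence of the entropy and of the maximal correlation against every centered
`μ ∈ P_1`. -/
theorem maxCorr_entropy_approx_source {d : ℕ} (hd : 1 ≤ d)
    (ρ : Measure (Ed d)) [IsProbabilityMeasure ρ] (hρ1 : FirstMoment ρ) :
    ∃ ρs : ℕ → Measure (Ed d),
      (∀ n, IsProbabilityMeasure (ρs n)) ∧
      (∀ n, ∃ K : Set (Ed d), IsCompact K ∧ ρs n Kᶜ = 0) ∧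
      WeakConv ρs ρ ∧
      Tendsto (fun n => entropy (ρs n)) atTop (𝓝 (entropy ρ)) ∧
      (∀ μ : Measure (Ed d), IsProbabilityMeasure μ → FirstMoment μ → Centered μ →
        Tendsto (fun n => maxCorr (ρs n) μ) atTop (𝓝 (maxCorr ρ μ))) := by
  obtain ⟨N, hN⟩ : ∃ N : ℕ, ρ (Metric.closedBall 0 N) ≠ 0 := by
    by_contra! h
    have hu : ρ (⋃ n : ℕ, Metric.closedBall (0 : Ed d) n) = 0 := measure_iUnion_null h
    rw [Metric.iUnion_closedBall_nat, measure_univ] at hu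
    exact one_ne_zero hu
  let B : ℕ → Set (Ed d) := fun n => Metric.closedBall 0 ((n + N : ℕ) : ℝ)
  have hm : ∀ n, MeasurableSet (B n) := fun n => measurableSet_closedBall
  have hB : ∀ x, ∀ᶠ n in atTop, x ∈ B n := fun x => by
    filter_upwards [eventually_ge_atTop ⌈‖x‖⌉₊] with n hn
    have hle : (n : ℝ) ≤ ((n + N : ℕ) : ℝ) := by exact_mod_cast Nat.le_add_right n N
    exact mem_closedBall_zero_iff.2 ((Nat.ceil_le.1 hn).trans hle)
  have h0 : ∀ n, ρ (B n) ≠ 0 := fun n h => hN <| measure_mono_null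
    (Metric.closedBall_subset_closedBall (by exact_mod_cast Nat.le_add_left N n)) h
  refine ⟨fun n => ρ[|B n], fun n => ProbabilityTheory.cond_isProbabilityMeasure (h0 n),
    fun n => ⟨B n, isCompact_closedBall _ _, ?_⟩, weakConv_cond hm hB,
    tendsto_entropy_cond hρ1 hm hB h0, fun μ _ hμ hc => tendsto_maxCorr_cond hρ1 hμ hc hm hB h0⟩
  rw [ProbabilityTheory.cond_apply (hm n), Set.inter_compl_self, measure_empty, mul_zero]
end
end
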